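/- Let ⊕ and ⊕' be two sums of open sets in ℝ^d, each satisfying the six requirements exactly and each producing bulky outputs (A ⊕ B and A ⊕' B are bulky for all bounded open A, B). Then ⊕ and ⊕' coincide: A ⊕ B = A ⊕' B for all bounded open sets A, B ⊆ ℝ^d. -/

import Mathlib

open MeasureTheory Metric Bornology

/-- Points of `ℝ^d`. -/
abbrev Pt (d : ℕ) := EuclideanSpace ℝ (Fin d)

/-- A cubic isometry: a linear isometry of ℝ^d mapping the cube [−1,1]^d to itself. -/
def CubicIsometry {d : ℕ} (U : Pt d ≃ₗᵢ[ℝ] Pt d) : Prop :=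
  ⇑U '' {y : Pt d | ∀ i, |y i| ≤ 1} = {y : Pt d | ∀ i, |y i| ≤ 1}

/-- A bounded open set. -/
def GoodSet {d : ℕ} (A : Set (Pt d)) : Prop := IsOpen A ∧ Bornology.IsBounded A

/-- A sum of open sets satisfying the six requirements exactly: it sends bounded open
sets to open sets and is monotone, commutative, associative (when the intermediate sums
are bounded), translation invariant, invariant under cubic isometries, and conserves
Lebesgue measure. -/
structure SumAxioms (d : ℕ) (Φ : Set (Pt d) → Set (Pt d) → Set (Pt d)) : Prop where
  isOpen : ∀ A B, GoodSet A → GoodSet B → IsOpen (Φ A B)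
  subset_sum : ∀ A B, GoodSet A → GoodSet B → A ⊆ Φ A B
  mono : ∀ A B C, GoodSet A → GoodSet B → GoodSet C → A ⊆ B → Φ A C ⊆ Φ B C
  comm : ∀ A B, GoodSet A → GoodSet B → Φ A B = Φ B A
  assoc : ∀ A B C, GoodSet A → GoodSet B → GoodSet C →
      Bornology.IsBounded (Φ A B) → Bornology.IsBounded (Φ B C) →
      Φ (Φ A B) C = Φ A (Φ B C)
  translate : ∀ (A B : Set (Pt d)) (x : Pt d), GoodSet A → GoodSet B →
      Φ ((· + x) '' A) ((· + x) '' B) = (· + x) '' (Φ A B)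
  rotate : ∀ (A B : Set (Pt d)) (U : Pt d ≃ₗᵢ[ℝ] Pt d), CubicIsometry U →
      GoodSet A → GoodSet B → Φ (⇑U '' A) (⇑U '' B) = ⇑U '' (Φ A B)
  conserve : ∀ A B, GoodSet A → GoodSet B → volume (Φ A B) = volume A + volume B

/-- An open set is *bulky* if it contains every open set essentially equal to it
(i.e. whose symmetric difference with it has Lebesgue measure zero). -/
def Bulky {d : ℕ} (U : Set (Pt d)) : Prop :=
  IsOpen U ∧ ∀ V : Set (Pt d), IsOpen V → volume (symmDiff V U) = 0 → V ⊆ U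

/-- `bulk A` is the bulky open set essentially equal to an open set `A`: the union of all
open sets essentially contained in `A`. -/
def bulk {d : ℕ} (A : Set (Pt d)) : Set (Pt d) :=
  ⋃₀ {B : Set (Pt d) | IsOpen B ∧ volume (B \ A) = 0}

section

structure Sys (d : ℕ) (Φ : Set (Pt d) → Set (Pt d) → Set (Pt d)) : Prop where
  ax : SumAxioms d Φ
  bulky : ∀ A B, GoodSet A → GoodSet B → Bulky (Φ A B)

lemma good_ball {d : ℕ} (x : Pt d) (r : ℝ) : GoodSet (ball x r) := ⟨isOpen_ball, isBounded_ball⟩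

lemma GoodSet.inter {d : ℕ} {A B : Set (Pt d)} (hA : GoodSet A) (hB : GoodSet B) :
    GoodSet (A ∩ B) := ⟨hA.1.inter hB.1, hA.2.subset Set.inter_subset_left⟩

lemma GoodSet.diff {d : ℕ} {A B : Set (Pt d)} (hA : GoodSet A) (hB : IsClosed B) :
    GoodSet (A \ B) := ⟨hA.1.sdiff hB, hA.2.subset Set.sdiff_subset⟩

lemma GoodSet.lt_top {d : ℕ} {A : Set (Pt d)} (hA : GoodSet A) : volume A ≠ ⊤ :=
  hA.2.measure_lt_top.ne

lemma GoodSet.trans {d : ℕ} {A : Set (Pt d)} (hA : GoodSet A) (x : Pt d) :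
    GoodSet ((· + x) '' A) := by
  refine ⟨?_, ?_⟩
  · exact (Homeomorph.addRight x).isOpenMap _ hA.1
  · obtain ⟨r, hr⟩ := hA.2.subset_closedBall 0
    refine (isBounded_closedBall (x := x) (r := r)).subset ?_
    rintro _ ⟨y, hy, rfl⟩
    have := hr hy
    simp [dist_eq_norm] at this ⊢
    exact this

lemma trans_ball {d : ℕ} (x v : Pt d) (r : ℝ) : (· + v) '' ball x r = ball (x + v) r := by
  ext z
  simp only [Set.mem_image, mem_ball]
  constructor
  · rintro ⟨y, hy, rfl⟩; simpa using hy
  · intro h; refine ⟨z - v, ?_, by simp⟩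
    rw [dist_eq_norm] at h ⊢
    convert h using 2; abel

lemma Bulky.sub {d : ℕ} {U V : Set (Pt d)} (hU : Bulky U) (hV : IsOpen V)
    (h : volume (V \ U) = 0) : V ⊆ U := by
  refine (Set.subset_union_left (t := U)).trans (hU.2 (V ∪ U) (hV.union hU.1) ?_)
  rw [Set.symmDiff_def]
  simp [Set.sdiff_eq_empty.2, h]

namespace Sys
variable {d : ℕ} {Φ : Set (Pt d) → Set (Pt d) → Set (Pt d)}

lemma mono2 (S : Sys d Φ) {A B A' B' : Set (Pt d)} (hA : GoodSet A) (hB : GoodSet B)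
    (hA' : GoodSet A') (hB' : GoodSet B') (h1 : A ⊆ A') (h2 : B ⊆ B') : Φ A B ⊆ Φ A' B' := by
  refine (S.ax.mono _ _ _ hA hA' hB h1).trans ?_
  rw [S.ax.comm _ _ hA' hB, S.ax.comm _ _ hA' hB']
  exact S.ax.mono _ _ _ hB hB' hA' h2

lemma sub_l (S : Sys d Φ) {A B : Set (Pt d)} (hA : GoodSet A) (hB : GoodSet B) : A ⊆ Φ A B :=
  S.ax.subset_sum _ _ hA hB

lemma sub_r (S : Sys d Φ) {A B : Set (Pt d)} (hA : GoodSet A) (hB : GoodSet B) : B ⊆ Φ A B := by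
  rw [S.ax.comm _ _ hA hB]; exact S.ax.subset_sum _ _ hB hA

lemma isom_ball0 (U : Pt d ≃ₗᵢ[ℝ] Pt d) (r : ℝ) : U '' ball 0 r = ball 0 r := by
  rw [LinearIsometryEquiv.image_ball]; simp

lemma sym (S : Sys d Φ) (x : Pt d) (s a : ℝ) (U : Pt d ≃ₗᵢ[ℝ] Pt d) (hU : CubicIsometry U)
    {y : Pt d} (hy : x + y ∈ Φ (ball x s) (ball x a)) : x + U y ∈ Φ (ball x s) (ball x a) := by
  have h1 : Φ (ball x s) (ball x a) = (· + x) '' Φ (ball 0 s) (ball 0 a) := by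
    rw [← S.ax.translate _ _ _ (good_ball _ _) (good_ball _ _), trans_ball, trans_ball, zero_add]
  have h2 := S.ax.rotate _ _ U hU (good_ball 0 s) (good_ball 0 a)
  rw [isom_ball0, isom_ball0] at h2
  rw [h1] at hy ⊢
  obtain ⟨z, hz, hz'⟩ := hy
  have : z = y := by simpa [add_comm] using hz'
  subst this
  refine ⟨U z, ?_, add_comm _ _⟩
  rw [h2]; exact ⟨z, hz, rfl⟩

lemma neg_cubic : CubicIsometry (LinearIsometryEquiv.neg ℝ (E := Pt d)) := by
  unfold CubicIsometry
  ext y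
  simp only [Set.mem_image, Set.mem_ofPred_eq]
  constructor
  · rintro ⟨z, hz, rfl⟩ i; simpa using hz i
  · intro h; exact ⟨-y, fun i => by simpa using h i, by simp⟩

lemma loc [NeZero d] (S : Sys d Φ) : ∃ C : ℝ, 1 ≤ C ∧ ∀ (x : Pt d) (s : ℝ), 0 < s →
    Φ (ball x s) (ball x s) ⊆ closedBall x (C * s) := by
  obtain ⟨ε, hε, hε2⟩ : ∃ ε : ℝ, 0 < ε ∧ (1 + ε) ^ d < 2 := by
    have : Filter.Tendsto (fun ε : ℝ => (1 + ε) ^ d) (nhdsWithin 0 (Set.Ioi 0)) (nhds ((1 + 0) ^ d)) := by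
      apply Filter.Tendsto.mono_left _ nhdsWithin_le_nhds
      exact Continuous.tendsto (by fun_prop) 0
    have h2 := this.eventually (gt_mem_nhds (show ((1:ℝ) + 0) ^ d < 2 by norm_num))
    obtain ⟨ε, h3, h4⟩ := (h2.and self_mem_nhdsWithin).exists
    exact ⟨ε, h4, h3⟩
  refine ⟨1 + 2 / ε, ?_, ?_⟩
  · have : 0 < 2 / ε := by positivity
    linarith
  intro x s hs y hy
  by_contra hcon
  set r := s / ε with hr
  have hrpos : 0 < r := by positivity
  have hsr : s = ε * r := by rw [hr]; field_simp
  have hd : s + 2 * r < dist y x := by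
    have : ¬ dist y x ≤ (1 + 2 / ε) * s := hcon
    have e : (1 + 2 / ε) * s = s + 2 * r := by rw [hr]; ring
    rw [e] at this; linarith
  set W := Φ (ball x (s + r)) (ball x (s + r)) with hW
  have h1 : ball y r ⊆ W := by
    intro z hz
    have : z ∈ (· + (z - y)) '' Φ (ball x s) (ball x s) := ⟨y, hy, by simp⟩
    rw [← S.ax.translate _ _ _ (good_ball _ _) (good_ball _ _), trans_ball] at this
    have hsub : ball (x + (z - y)) s ⊆ ball x (s + r) := by
      apply ball_subset_ball'
      have : dist (x + (z - y)) x = dist z y := by simp [dist_eq_norm]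
      rw [this]; have := mem_ball.1 hz; linarith
    exact S.mono2 (good_ball _ _) (good_ball _ _) (good_ball _ _) (good_ball _ _) hsub hsub this
  have h2 : ball (x + x - y) r ⊆ W := by
    intro z hz
    have : x + (x - z) ∈ W := by
      apply h1
      rw [mem_ball, dist_eq_norm] at hz ⊢
      have e : x + (x - z) - y = -(z - (x + x - y)) := by abel
      rw [e, norm_neg]; exact hz
    have := S.sym x _ _ _ neg_cubic this
    simpa using this
  have h3 : ball x (s + r) ⊆ W := S.sub_l (good_ball _ _) (good_ball _ _)
  have d1 : Disjoint (ball x (s + r)) (ball y r) := by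
    apply ball_disjoint_ball; rw [dist_comm]; linarith
  have d2 : Disjoint (ball x (s + r)) (ball (x + x - y) r) := by
    apply ball_disjoint_ball
    have : dist x (x + x - y) = dist y x := by
      rw [dist_eq_norm, dist_eq_norm]; congr 1; abel
    rw [this]; linarith
  have d3 : Disjoint (ball y r) (ball (x + x - y) r) := by
    apply ball_disjoint_ball
    have : dist y (x + x - y) = 2 * dist y x := by
      rw [dist_eq_norm, dist_eq_norm]
      have : y - (x + x - y) = (2:ℝ) • (y - x) := by rw [two_smul]; abel
      rw [this, norm_smul]; simp
    rw [this]; linarith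
  have hvol : volume (ball x (s + r) ∪ (ball y r ∪ ball (x + x - y) r)) ≤ volume W :=
    measure_mono (Set.union_subset h3 (Set.union_subset h1 h2))
  rw [measure_union (d1.union_right d2) (isOpen_ball.union isOpen_ball).measurableSet,
    measure_union d3 isOpen_ball.measurableSet, hW,
    S.ax.conserve _ _ (good_ball _ _) (good_ball _ _)] at hvol
  rw [ENNReal.add_le_add_iff_left (good_ball x _).lt_top] at hvol
  rw [Measure.addHaar_ball _ y hrpos.le, Measure.addHaar_ball _ (x + x - y) hrpos.le,
    Measure.addHaar_ball _ x (by positivity), ← add_mul] at hvol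
  rw [ENNReal.mul_le_mul_iff_left (measure_ball_pos _ _ one_pos).ne' (good_ball _ _).lt_top,
    ← ENNReal.ofReal_add (by positivity) (by positivity),
    ENNReal.ofReal_le_ofReal_iff (by positivity)] at hvol
  simp only [finrank_euclideanSpace, Fintype.card_fin] at hvol
  have : (s + r) ^ d = (1 + ε) ^ d * r ^ d := by rw [← mul_pow, hsr]; ring_nf
  rw [this] at hvol
  have : 0 < r ^ d := by positivity
  nlinarith

lemma good [NeZero d] (S : Sys d Φ) {A B : Set (Pt d)} (hA : GoodSet A) (hB : GoodSet B) :
    GoodSet (Φ A B) := by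
  refine ⟨S.ax.isOpen _ _ hA hB, ?_⟩
  obtain ⟨C, -, hC⟩ := S.loc
  obtain ⟨r, hr, hr'⟩ := (hA.2.union hB.2).subset_ball_lt 0 0
  refine (isBounded_closedBall (x := 0) (r := C * r)).subset ?_
  refine subset_trans ?_ (hC 0 r hr)
  exact S.mono2 hA hB (good_ball _ _) (good_ball _ _) (Set.subset_union_left.trans hr')
    (Set.subset_union_right.trans hr')

lemma cons [NeZero d] (S : Sys d Φ) {A B : Set (Pt d)} (hA : GoodSet A) (hB : GoodSet B) :
    volume.real (Φ A B) = volume.real A + volume.real B := by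
  simp only [measureReal_def]
  rw [S.ax.conserve _ _ hA hB, ENNReal.toReal_add hA.lt_top hB.lt_top]

lemma assoc' [NeZero d] (S : Sys d Φ) {A B C : Set (Pt d)} (hA : GoodSet A) (hB : GoodSet B)
    (hC : GoodSet C) : Φ (Φ A B) C = Φ A (Φ B C) :=
  S.ax.assoc _ _ _ hA hB hC (S.good hA hB).2 (S.good hB hC).2

lemma eq_of_sub (_S : Sys d Φ) {U V : Set (Pt d)} (hU : Bulky U) (hV : IsOpen V)
    (h : U ⊆ V) (hfin : volume U ≠ ⊤) (hm : volume V ≤ volume U) : U = V := by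
  refine subset_antisymm h (hU.sub hV ?_)
  rw [measure_sdiff h hU.1.measurableSet.nullMeasurableSet hfin]
  exact tsub_eq_zero_of_le hm

/-- split -/
lemma split [NeZero d] (S : Sys d Φ) {A B B' b : Set (Pt d)} (hA : GoodSet A) (hB : GoodSet B)
    (hB' : GoodSet B') (hb : GoodSet b) (h1 : B' ⊆ B) (h2 : b ⊆ B) (hd : Disjoint B' b)
    (hm : volume (B \ (B' ∪ b)) = 0) : Φ A B = Φ (Φ A B') b := by
  have hvol : volume B = volume B' + volume b := by
    rw [← measure_union hd hb.1.measurableSet]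
    refine le_antisymm ?_ (measure_mono (Set.union_subset h1 h2))
    have := measure_le_inter_add_sdiff volume B (B' ∪ b)
    rw [hm, add_zero] at this
    exact this.trans (measure_mono Set.inter_subset_right)
  have hsub : B ⊆ Φ B' b := by
    refine (S.bulky _ _ hB' hb).sub hB.1 (measure_mono_null ?_ hm)
    exact Set.sdiff_subset_sdiff_right (Set.union_subset (S.sub_l hB' hb) (S.sub_r hB' hb))
  rw [S.assoc' hA hB' hb]
  refine S.eq_of_sub (S.bulky _ _ hA hB) (S.good hA (S.good hB' hb)).1
    (S.mono2 hA hB hA (S.good hB' hb) le_rfl hsub) (S.good hA hB).lt_top ?_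
  rw [S.ax.conserve _ _ hA hB, S.ax.conserve _ _ hA (S.good hB' hb), S.ax.conserve _ _ hB' hb, hvol]

end Sys

end

section

def CSym {d : ℕ} (E : Set (Pt d)) : Prop :=
  ∀ U : Pt d ≃ₗᵢ[ℝ] Pt d, CubicIsometry U → ∀ y ∈ E, U y ∈ E

noncomputable def FF {d : ℕ} (h : Pt d → ℝ) (Φ : Set (Pt d) → Set (Pt d) → Set (Pt d))
    (A B : Set (Pt d)) : ℝ := (∫ x in Φ A B, h x) - (∫ x in A, h x) - ∫ x in B, h x

section aux
variable {d : ℕ} {h : Pt d → ℝ}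

lemma intOn (hc : Continuous h) {A : Set (Pt d)} (hA : IsBounded A) : IntegrableOn h A :=
  (hc.locallyIntegrable.integrableOn_isCompact hA.isCompact_closure).mono_set subset_closure

lemma int_le (hc : Continuous h) {E : Set (Pt d)} (hE : MeasurableSet E) (hb : IsBounded E)
    {c : ℝ} (hle : ∀ y ∈ E, h y ≤ c) : ∫ x in E, h x ≤ volume.real E * c := by
  have := setIntegral_mono_on (intOn hc hb) (integrableOn_const hb.measure_lt_top.ne (C := c)) hE hle
  rwa [setIntegral_const, smul_eq_mul] at this

lemma le_int (hc : Continuous h) {E : Set (Pt d)} (hE : MeasurableSet E) (hb : IsBounded E)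
    {c : ℝ} (hle : ∀ y ∈ E, c ≤ h y) : volume.real E * c ≤ ∫ x in E, h x := by
  have := setIntegral_mono_on (integrableOn_const hb.measure_lt_top.ne (C := c)) (intOn hc hb) hE hle
  rwa [setIntegral_const, smul_eq_mul] at this

lemma int_split (hc : Continuous h) {E : Set (Pt d)} (hb : IsBounded E) {F : Set (Pt d)}
    (hF : MeasurableSet F) : ∫ x in E, h x = (∫ x in E ∩ F, h x) + ∫ x in E \ F, h x :=
  (integral_inter_add_sdiff hF (intOn hc hb)).symm

lemma vol_split {E : Set (Pt d)} (hb : IsBounded E) {F : Set (Pt d)}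
    (hF : MeasurableSet F) : volume.real E = volume.real (E ∩ F) + volume.real (E \ F) :=
  (measureReal_inter_add_sdiff hF hb.measure_lt_top.ne).symm

end aux

namespace Sys
variable {d : ℕ} [NeZero d] {Φ : Set (Pt d) → Set (Pt d) → Set (Pt d)} {h : Pt d → ℝ}

lemma int_split_ball (hc : Continuous h) {E : Set (Pt d)} (hb : IsBounded E) (x : Pt d) (s : ℝ) :
    ∫ z in E, h z = (∫ z in E ∩ ball x s, h z) + ∫ z in E \ closedBall x s, h z := by
  rw [int_split hc hb (F := closedBall x s) isClosed_closedBall.measurableSet]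
  congr 1
  apply setIntegral_congr_set
  refine Filter.EventuallyEq.rfl.inter ?_
  have : ball x s ∪ sphere x s = closedBall x s := ball_union_sphere
  rw [← this]
  have h0 : (sphere x s : Set (Pt d)) =ᵐ[volume] (∅ : Set (Pt d)) := by
    rw [ae_eq_empty]; exact Measure.addHaar_sphere _ x s
  exact union_ae_eq_left_of_ae_eq_empty h0

lemma initial (S : Sys d Φ) (hc : Continuous h) {K : ℝ} (hK : ∀ x, |h x| ≤ K)
    {A B : Set (Pt d)} (hA : GoodSet A) (hB : GoodSet B) :
    FF h Φ A B ≤ 2 * K * volume.real (A ∩ B) := by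
  have hG := S.good hA hB
  have hAB : A ∪ B ⊆ Φ A B := Set.union_subset (S.sub_l hA hB) (S.sub_r hA hB)
  have mA := hA.1.measurableSet
  have mB := hB.1.measurableSet
  have e1 := int_split hc hG.2 (mA.union mB)
  rw [Set.inter_eq_right.2 hAB] at e1
  have e2 := int_split hc hA.2 mB
  have e3 := int_split hc (hA.2.union hB.2) mB
  have v1 := vol_split hG.2 (mA.union mB)
  rw [Set.inter_eq_right.2 hAB] at v1
  have v2 := vol_split hA.2 mB
  have v3 := vol_split (hA.2.union hB.2) mB
  rw [Set.union_inter_cancel_right, Set.union_sdiff_right] at e3 v3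
  have v4 := S.cons hA hB
  have b1 := int_le hc (hG.1.measurableSet.diff (mA.union mB)) (hG.2.subset Set.sdiff_subset)
    (c := K) (fun y _ => (abs_le.1 (hK y)).2)
  have b2 := le_int hc (mA.inter mB) (hA.2.subset Set.inter_subset_left)
    (c := -K) (fun y _ => (abs_le.1 (hK y)).1)
  have v5 : volume.real (Φ A B \ (A ∪ B)) = volume.real (A ∩ B) := by linarith
  rw [v5] at b1
  unfold FF
  linarith

lemma stepS (S : Sys d Φ) (hc : Continuous h) {Ω₀ : Set (Pt d)} {δ ρ : ℝ} (hδ : 0 < δ)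
    (SH : ∀ x ∈ Ω₀, ∀ E, MeasurableSet E → CSym E → E ⊆ closedBall 0 ρ →
      ∫ y in E, h (x + y) ≤ volume.real E * h x - δ * ∫ y in E, ‖y‖ ^ 2)
    {C : ℝ} (hC : ∀ (x : Pt d) (s : ℝ), 0 < s →
      Φ (ball x s) (ball x s) ⊆ closedBall x (C * s))
    {Θ : ℝ} (hΘ0 : 0 ≤ Θ) (hΘ : ∀ A B, GoodSet A → GoodSet B → Φ A B ⊆ Ω₀ →
      FF h Φ A B ≤ Θ * volume.real (A ∩ B))
    {s : ℝ} (hs : 0 < s) (hsρ : C * s ≤ ρ) (o1 : ∀ x y, dist y x ≤ C * s → |h y - h x| ≤ Θ / 2)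
    {a₀ : ℝ} (ha₀ : a₀ ≤ s) (o2 : ∀ x y, dist y x ≤ a₀ → |h y - h x| ≤ δ * s ^ 2 / 2)
    {D : Set (Pt d)} (hD : GoodSet D) {x : Pt d} {a : ℝ} (ha : 0 < a) (haa : a ≤ a₀)
    (hsub : Φ D (ball x a) ⊆ Ω₀) :
    FF h Φ D (ball x a) ≤ (Θ - δ * s ^ 2 / 2) * volume.real (ball x a) := by
  set b := ball x a with hb
  have gb : GoodSet b := good_ball _ _
  set Q := ball x s with hQ
  have gQ : GoodSet Q := good_ball _ _
  have bQ : b ⊆ Q := ball_subset_ball (haa.trans ha₀)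
  set Ds := D ∩ Q with hDs
  have gDs : GoodSet Ds := hD.inter gQ
  set Do := D \ closedBall x s with hDo
  have gDo : GoodSet Do := hD.diff isClosed_closedBall
  set T := Φ Ds b with hT
  have gT : GoodSet T := S.good gDs gb
  set N := Φ Q b with hN
  have gN : GoodSet N := S.good gQ gb
  have xb : x ∈ b := mem_ball_self ha
  have xΩ : x ∈ Ω₀ := hsub (S.sub_r hD gb xb)
  have TN : T ⊆ N := S.mono2 gDs gb gQ gb Set.inter_subset_right le_rfl
  have NC : N ⊆ closedBall x (C * s) :=
    (S.mono2 gQ gb gQ gQ le_rfl bQ).trans (hC x s hs)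
  have QN : Q ⊆ N := S.sub_l gQ gb
  have TΩ : T ⊆ Φ D b := S.mono2 gDs gb hD gb Set.inter_subset_left le_rfl
  have hsplit : Φ D b = Φ Do T := by
    rw [S.ax.comm _ _ hD gb, S.split gb hD gDs gDo Set.inter_subset_left Set.sdiff_subset,
      S.ax.comm _ _ gb gDs, S.ax.comm _ _ gT gDo]
    · rw [Set.disjoint_left]
      intro z hz hz'
      exact hz'.2 (ball_subset_closedBall hz.2)
    · refine measure_mono_null ?_ (Measure.addHaar_sphere volume x s)
      intro z hz
      have h1 : ¬ z ∈ Q := fun hh => hz.2 (Or.inl ⟨hz.1, hh⟩)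
      have h2 : z ∈ closedBall x s := by
        by_contra hh; exact hz.2 (Or.inr ⟨hz.1, hh⟩)
      simp only [hQ, mem_ball, mem_closedBall, mem_sphere] at *
      linarith
  have mQ := gQ.1.measurableSet
  have mT := gT.1.measurableSet
  have mN := gN.1.measurableSet
  have mDs := gDs.1.measurableSet
  have F1 : FF h Φ Do T ≤ Θ * volume.real (T \ Q) := by
    refine (hΘ _ _ gDo gT (hsplit ▸ hsub)).trans ?_
    refine mul_le_mul_of_nonneg_left (measureReal_mono ?_ ?_) hΘ0
    · rintro z ⟨hz1, hz2⟩
      exact ⟨hz2, fun hh => hz1.2 (ball_subset_closedBall hh)⟩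
    · exact (gT.2.subset Set.sdiff_subset).measure_lt_top.ne
  have iD := int_split_ball hc hD.2 x s
  have F2 : FF h Φ D b = FF h Φ Do T + ((∫ z in T, h z) - (∫ z in Ds, h z) - ∫ z in b, h z) := by
    unfold FF
    rw [hsplit, iD]; ring
  -- decomposition
  have iT1 := int_split hc gT.2 mQ
  have vT1 := vol_split gT.2 mQ
  have bTQ : IsBounded (T ∩ Q) := gT.2.subset Set.inter_subset_left
  have DsTQ : Ds ⊆ T ∩ Q := Set.subset_inter (S.sub_l gDs gb) Set.inter_subset_right
  have iT2 := int_split hc bTQ mDs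
  have vT2 := vol_split bTQ mDs
  rw [Set.inter_eq_right.2 DsTQ] at iT2 vT2
  set P := (T ∩ Q) \ Ds with hP
  have bNQ : IsBounded (N \ Q) := gN.2.subset Set.sdiff_subset
  have iN := int_split hc bNQ mT
  have vN := vol_split bNQ mT
  have eNT : (N \ Q) ∩ T = T \ Q := by
    ext z; constructor
    · rintro ⟨⟨_, h2⟩, h3⟩; exact ⟨h3, h2⟩
    · rintro ⟨h1, h2⟩; exact ⟨⟨TN h1, h2⟩, h1⟩
  rw [eNT] at iN vN
  set R := (N \ Q) \ T with hR
  have vN2 := vol_split gN.2 mQ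
  rw [Set.inter_eq_right.2 QN] at vN2
  have c1 := S.cons gQ gb
  have c2 := S.cons gDs gb
  have PC : ∀ z ∈ P, h z ≤ h x + Θ / 2 := fun z hz => by
    have := (abs_le.1 (o1 x z (NC (TN hz.1.1)))).2; linarith
  have RC : ∀ z ∈ R, h x - Θ / 2 ≤ h z := fun z hz => by
    have := (abs_le.1 (o1 x z (NC hz.1.1))).1; linarith
  have bC : ∀ z ∈ b, h x - δ * s ^ 2 / 2 ≤ h z := fun z hz => by
    have := (abs_le.1 (o2 x z ((mem_ball.1 hz).le.trans haa))).1; linarith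
  have iP := int_le hc ((mT.inter mQ).diff mDs) (bTQ.subset Set.sdiff_subset) PC
  have iR := le_int hc ((mN.diff mQ).diff mT) (bNQ.subset Set.sdiff_subset) RC
  have ib := le_int hc gb.1.measurableSet gb.2 bC
  -- the symmetric part
  have mp := measurePreserving_add_left (volume : Measure (Pt d)) x
  have me := measurableEmbedding_addLeft x
  set E := (x + ·) ⁻¹' (N \ Q) with hE
  have mE : MeasurableSet E := me.measurable (mN.diff mQ)
  have eE : ∫ y in E, h (x + y) = ∫ z in N \ Q, h z := mp.setIntegral_preimage_emb me h (N \ Q)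
  have vE : volume.real E = volume.real (N \ Q) := by
    simp only [measureReal_def]
    rw [mp.measure_preimage (mN.diff mQ).nullMeasurableSet]
  have sE : CSym E := by
    intro U hU y hy
    refine ⟨S.sym x s a U hU hy.1, ?_⟩
    intro hh
    apply hy.2
    simp only [hQ, mem_ball, dist_eq_norm, add_sub_cancel_left] at hh ⊢
    rwa [LinearIsometryEquiv.norm_map] at hh
  have cE : E ⊆ closedBall 0 ρ := by
    intro y hy
    have := NC hy.1
    simp only [mem_closedBall, dist_eq_norm, add_sub_cancel_left, sub_zero] at this ⊢
    linarith
  have i1 := SH x xΩ E mE sE cE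
  have i2 := le_int (h := fun y : Pt d => ‖y‖ ^ 2) (by fun_prop) mE (isBounded_closedBall.subset cE)
    (c := s ^ 2) (by
      intro y hy
      have := hy.2
      simp only [hQ, mem_ball, dist_eq_norm, add_sub_cancel_left, not_lt] at this
      exact pow_le_pow_left₀ hs.le this 2)
  rw [eE, vE] at i1
  rw [vE] at i2
  have vb : volume.real (N \ Q) = volume.real b := by linarith
  have vPR : volume.real P = volume.real R := by linarith
  rw [vb] at i1 i2
  have i3 := mul_le_mul_of_nonneg_left i2 hδ.le
  rw [vPR] at iP
  have vbR : volume.real b = volume.real R + volume.real (T \ Q) := by linarith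
  rw [F2]
  have key : (∫ z in T, h z) - (∫ z in Ds, h z) - ∫ z in b, h z
      ≤ Θ * volume.real R - δ * s ^ 2 / 2 * volume.real b := by
    have e : (∫ z in T, h z) - (∫ z in Ds, h z) - ∫ z in b, h z =
      (∫ z in P, h z) - (∫ z in R, h z) + (∫ z in N \ Q, h z) - ∫ z in b, h z := by linarith
    rw [e]
    linarith
  rw [vbR] at key ⊢
  linarith

lemma ind (S : Sys d Φ) (hc : Continuous h) {Ω₀ : Set (Pt d)} {Θ g a₀ : ℝ}
    (hΘ : ∀ A B, GoodSet A → GoodSet B → Φ A B ⊆ Ω₀ → FF h Φ A B ≤ Θ * volume.real (A ∩ B))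
    (hS : ∀ D x a, GoodSet D → 0 < a → a ≤ a₀ → Φ D (ball x a) ⊆ Ω₀ →
      FF h Φ D (ball x a) ≤ (Θ - g) * volume.real (ball x a))
    {A : Set (Pt d)} (hA : GoodSet A) (r : Pt d → ℝ) (t : Finset (Pt d)) :
    ∀ B, GoodSet B → Φ A B ⊆ Ω₀ → (∀ x ∈ t, 0 < r x ∧ r x ≤ a₀ ∧ closedBall x (r x) ⊆ A ∩ B) →
      (t : Set (Pt d)).PairwiseDisjoint (fun x => closedBall x (r x)) →
      FF h Φ A B ≤ Θ * volume.real (A ∩ B) - g * ∑ x ∈ t, volume.real (ball x (r x)) := by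
  induction t using Finset.induction_on with
  | empty => intro B hB hsub _ _; simpa using hΘ A B hA hB hsub
  | insert x t hx ih =>
    intro B hB hsub hr hd
    obtain ⟨hr1, hr2, hr3⟩ := hr x (Finset.mem_insert_self _ _)
    set b := ball x (r x) with hb
    have gb : GoodSet b := good_ball _ _
    have bAB : b ⊆ A ∩ B := ball_subset_closedBall.trans hr3
    set B' := B \ closedBall x (r x) with hB'
    have gB' : GoodSet B' := hB.diff isClosed_closedBall
    have hsub' : Φ A B' ⊆ Ω₀ := (S.mono2 hA gB' hA hB le_rfl Set.sdiff_subset).trans hsub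
    have hbd : Disjoint B' b := by
      rw [Set.disjoint_left]; intro z hz hz'
      exact hz.2 (ball_subset_closedBall hz')
    have hsplit : Φ A B = Φ (Φ A B') b := by
      refine S.split hA hB gB' gb Set.sdiff_subset (bAB.trans Set.inter_subset_right) hbd ?_
      refine measure_mono_null ?_ (Measure.addHaar_sphere volume x (r x))
      intro z hz
      have h1 : ¬ z ∈ b := fun hh => hz.2 (Or.inr hh)
      have h2 : z ∈ closedBall x (r x) := by
        by_contra hh; exact hz.2 (Or.inl ⟨hz.1, hh⟩)
      simp only [hb, mem_ball, mem_closedBall, mem_sphere] at *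
      linarith
    have I1 := ih B' gB' hsub' (by
      intro y hy
      obtain ⟨q1, q2, q3⟩ := hr y (Finset.mem_insert_of_mem hy)
      refine ⟨q1, q2, fun z hz => ⟨(q3 hz).1, (q3 hz).2, fun hh => ?_⟩⟩
      have hne : x ≠ y := fun e => hx (e ▸ hy)
      have := hd (Finset.mem_coe.2 (Finset.mem_insert_self _ _))
        (Finset.mem_coe.2 (Finset.mem_insert_of_mem hy)) hne
      exact Set.disjoint_left.1 this hh hz)
      (hd.subset (by simp))
    have I2 := hS (Φ A B') x (r x) (S.good hA gB') hr1 hr2 (hsplit ▸ hsub)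
    have iB := int_split_ball hc hB.2 x (r x)
    rw [Set.inter_eq_right.2 (bAB.trans Set.inter_subset_right)] at iB
    have F : FF h Φ A B = FF h Φ A B' + FF h Φ (Φ A B') b := by
      unfold FF; rw [hsplit, iB]; ring
    have v := vol_split (hA.2.subset (Set.inter_subset_left (t := B)))
      (isClosed_closedBall (x := x) (ε := r x)).measurableSet
    rw [Set.inter_eq_right.2 hr3] at v
    have e : (A ∩ B) \ closedBall x (r x) = A ∩ B' := by
      rw [hB', Set.inter_sdiff_assoc]
    rw [e] at v
    have v2 : volume.real (closedBall x (r x)) = volume.real b := by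
      simp only [measureReal_def, hb, Measure.addHaar_closedBall_eq_addHaar_ball]
    rw [v2] at v
    rw [Finset.sum_insert hx, F, v]
    linarith

lemma full (S : Sys d Φ) (hc : Continuous h) {Ω₀ : Set (Pt d)} {Θ g a₀ : ℝ} (hg : 0 < g)
    (ha₀ : 0 < a₀)
    (hΘ : ∀ A B, GoodSet A → GoodSet B → Φ A B ⊆ Ω₀ → FF h Φ A B ≤ Θ * volume.real (A ∩ B))
    (hS : ∀ D x a, GoodSet D → 0 < a → a ≤ a₀ → Φ D (ball x a) ⊆ Ω₀ →
      FF h Φ D (ball x a) ≤ (Θ - g) * volume.real (ball x a))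
    {A B : Set (Pt d)} (hA : GoodSet A) (hB : GoodSet B) (hsub : Φ A B ⊆ Ω₀) :
    FF h Φ A B ≤ (Θ - g) * volume.real (A ∩ B) := by
  have gAB := hA.inter hB
  obtain ⟨t, r, htc, hts, htr, hcov, hdis⟩ := Besicovitch.exists_disjoint_closedBall_covering_ae
    (volume : Measure (Pt d)) (fun x => {r | closedBall x r ⊆ A ∩ B}) (A ∩ B) (by
      intro x hx δ hδ
      obtain ⟨ε, hε, hε'⟩ := nhds_basis_closedBall.mem_iff.1 (gAB.1.mem_nhds hx)
      refine ⟨min ε (δ / 2), ?_, by positivity, ?_⟩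
      · exact (closedBall_subset_closedBall (min_le_left _ _)).trans hε'
      · exact (min_le_right _ _).trans_lt (by linarith)) (fun _ => a₀) (fun _ _ => ha₀)
  set X := (Θ * volume.real (A ∩ B) - FF h Φ A B) / g with hX
  have hX0 : 0 ≤ X := div_nonneg (by linarith [hΘ A B hA hB hsub]) hg.le
  have hle : volume (A ∩ B) ≤ ENNReal.ofReal X := by
    have h1 : volume (A ∩ B) ≤ volume (⋃ x ∈ t, closedBall x (r x)) := by
      have := measure_le_inter_add_sdiff volume (A ∩ B) (⋃ x ∈ t, closedBall x (r x))
      rw [hcov, add_zero] at this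
      exact this.trans (measure_mono Set.inter_subset_right)
    refine h1.trans ?_
    rw [measure_biUnion htc hdis (fun _ _ => isClosed_closedBall.measurableSet),
      ENNReal.tsum_eq_iSup_sum]
    refine iSup_le fun u => ?_
    have := S.ind hc hΘ hS hA r (u.map (Function.Embedding.subtype _)) B hB hsub (by
      intro x hx
      simp only [Finset.mem_map, Function.Embedding.subtype_apply] at hx
      obtain ⟨y, _, rfl⟩ := hx
      have := htr y y.2
      exact ⟨this.2.1, this.2.2.le, this.1⟩) (hdis.subset (by
        intro x hx
        simp only [Finset.coe_map, Set.mem_image] at hx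
        obtain ⟨y, _, rfl⟩ := hx
        exact y.2))
    rw [Finset.sum_map] at this
    have e : ∑ a ∈ u, volume (closedBall (a : Pt d) (r a)) =
        ENNReal.ofReal (∑ a ∈ u, volume.real (ball (a : Pt d) (r a))) := by
      rw [ENNReal.ofReal_sum_of_nonneg (fun _ _ => measureReal_nonneg)]
      refine Finset.sum_congr rfl fun a _ => ?_
      rw [Measure.addHaar_closedBall_eq_addHaar_ball, ofReal_measureReal (good_ball _ _).lt_top]
    rw [e]
    apply ENNReal.ofReal_le_ofReal
    rw [hX, le_div_iff₀ hg]
    simp only [Function.Embedding.subtype_apply] at this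
    linarith
  have : volume.real (A ∩ B) ≤ X := ENNReal.toReal_le_of_le_ofReal hX0 hle
  rw [hX, le_div_iff₀ hg] at this
  linarith

/-- Key lemma -/
lemma key (S : Sys d Φ) (hc : UniformContinuous h) {K : ℝ} (hK : ∀ x, |h x| ≤ K)
    {A B : Set (Pt d)} (hA : GoodSet A) (hB : GoodSet B) {δ ρ : ℝ} (hδ : 0 < δ) (hρ : 0 < ρ)
    (SH : ∀ x ∈ Φ A B, ∀ E, MeasurableSet E → CSym E → E ⊆ closedBall 0 ρ →
      ∫ y in E, h (x + y) ≤ volume.real E * h x - δ * ∫ y in E, ‖y‖ ^ 2) :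
    ∫ x in Φ A B, h x ≤ (∫ x in A, h x) + ∫ x in B, h x := by
  set Ω₀ := Φ A B with hΩ
  have hcc := hc.continuous
  obtain ⟨C, hC1, hC⟩ := S.loc
  set Ts : Set ℝ := {Θ | 0 ≤ Θ ∧ ∀ A B, GoodSet A → GoodSet B → Φ A B ⊆ Ω₀ →
      FF h Φ A B ≤ Θ * volume.real (A ∩ B)} with hTs
  have hK0 : 0 ≤ K := (abs_nonneg _).trans (hK 0)
  have hne : Ts.Nonempty := ⟨2 * K, by positivity, fun A B hA hB _ => S.initial hcc hK hA hB⟩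
  have hbdd : BddBelow Ts := ⟨0, fun _ h => h.1⟩
  set Θ := sInf Ts with hΘdef
  have hΘ0 : 0 ≤ Θ := le_csInf hne fun _ h => h.1
  have hΘ : ∀ A B, GoodSet A → GoodSet B → Φ A B ⊆ Ω₀ →
      FF h Φ A B ≤ Θ * volume.real (A ∩ B) := by
    intro A B hA hB hsub
    apply le_of_forall_pos_le_add
    intro ε hε
    have hv : 0 ≤ volume.real (A ∩ B) := measureReal_nonneg
    obtain ⟨Θ', h1, h2⟩ := exists_lt_of_csInf_lt hne
      (show Θ < Θ + ε / (volume.real (A ∩ B) + 1) by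
        have : 0 < ε / (volume.real (A ∩ B) + 1) := by positivity
        linarith)
    refine (h1.2 A B hA hB hsub).trans ?_
    have h3 := mul_le_mul_of_nonneg_right h2.le hv
    refine h3.trans ?_
    rw [add_mul]
    have : ε / (volume.real (A ∩ B) + 1) * volume.real (A ∩ B) ≤ ε := by
      rw [div_mul_eq_mul_div, div_le_iff₀ (by positivity)]
      nlinarith
    linarith
  rcases hΘ0.eq_or_lt with h0 | hpos
  · have := hΘ A B hA hB le_rfl
    rw [← h0] at this
    unfold FF at this
    linarith
  exfalso
  obtain ⟨s₁, hs₁, hs₁'⟩ := Metric.uniformContinuous_iff.1 hc (Θ / 2) (by positivity)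
  have hC0 : 0 < C := by linarith
  set s := min (ρ / C) (s₁ / (2 * C)) with hs
  have hspos : 0 < s := by positivity
  have hCs : C * s ≤ ρ := by
    have : s ≤ ρ / C := min_le_left _ _
    rw [le_div_iff₀ hC0] at this; linarith
  have hCs1 : C * s < s₁ := by
    have : s ≤ s₁ / (2 * C) := min_le_right _ _
    rw [le_div_iff₀ (by positivity)] at this; linarith
  obtain ⟨a₁, ha₁, ha₁'⟩ := Metric.uniformContinuous_iff.1 hc (δ * s ^ 2 / 2) (by positivity)
  set a₀ := min s (a₁ / 2) with ha₀
  have ha₀pos : 0 < a₀ := by positivity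
  have hg : 0 < δ * s ^ 2 / 2 := by positivity
  have hS : ∀ D x a, GoodSet D → 0 < a → a ≤ a₀ → Φ D (ball x a) ⊆ Ω₀ →
      FF h Φ D (ball x a) ≤ (Θ - δ * s ^ 2 / 2) * volume.real (ball x a) := by
    intro D x a hD ha haa hsub
    refine S.stepS hcc hδ SH hC hΘ0 hΘ hspos hCs ?_ (min_le_left _ _ : a₀ ≤ s) ?_ hD ha haa hsub
    · intro x y hxy
      have := hs₁' (hxy.trans_lt hCs1)
      rw [Real.dist_eq] at this; exact this.le
    · intro x y hxy
      have h2 : a₀ ≤ a₁ / 2 := min_le_right _ _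
      have := ha₁' (a := y) (b := x) (by linarith)
      rw [Real.dist_eq] at this; exact this.le
  have hmem : max 0 (Θ - δ * s ^ 2 / 2) ∈ Ts := by
    refine ⟨le_max_left _ _, fun A B hA hB hsub => ?_⟩
    refine (S.full hcc hg ha₀pos hΘ hS hA hB hsub).trans ?_
    exact mul_le_mul_of_nonneg_right (le_max_right _ _) measureReal_nonneg
  have hlt : max 0 (Θ - δ * s ^ 2 / 2) < Θ := max_lt hpos (by linarith)
  exact absurd (csInf_le hbdd hmem) (not_le.2 hlt)

end Sys

end

section

section symm
variable {d : ℕ}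

lemma cubic_of_invol {U : Pt d ≃ₗᵢ[ℝ] Pt d} (hU : ∀ y, U (U y) = y)
    (h : ∀ y : Pt d, (∀ i, |y i| ≤ 1) → ∀ i, |U y i| ≤ 1) : CubicIsometry U := by
  unfold CubicIsometry
  ext y
  simp only [Set.mem_image, Set.mem_ofPred_eq]
  constructor
  · rintro ⟨z, hz, rfl⟩; exact h z hz
  · intro hy; exact ⟨U y, h y hy, hU y⟩

noncomputable def flipI (i : Fin d) : Pt d ≃ₗᵢ[ℝ] Pt d :=
  LinearIsometryEquiv.piLpCongrRight 2
    (fun j => if j = i then LinearIsometryEquiv.neg ℝ else LinearIsometryEquiv.refl ℝ ℝ)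

lemma flipI_apply (i j : Fin d) (y : Pt d) : flipI i y j = if j = i then - y j else y j := by
  simp only [flipI, LinearIsometryEquiv.piLpCongrRight_apply]
  split_ifs with h <;> simp [h]

noncomputable def swapI (i j : Fin d) : Pt d ≃ₗᵢ[ℝ] Pt d :=
  LinearIsometryEquiv.piLpCongrLeft 2 ℝ ℝ (Equiv.swap i j)

lemma swapI_apply (i j k : Fin d) (y : Pt d) : swapI i j y k = y (Equiv.swap i j k) := by
  simp [swapI, LinearIsometryEquiv.piLpCongrLeft_apply, Equiv.piCongrLeft'_apply]

lemma flipI_invol (i : Fin d) (y : Pt d) : flipI i (flipI i y) = y := by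
  ext j; simp only [flipI_apply]; split_ifs <;> simp

lemma swapI_invol (i j : Fin d) (y : Pt d) : swapI i j (swapI i j y) = y := by
  ext k; simp only [swapI_apply]; simp

lemma flipI_cubic (i : Fin d) : CubicIsometry (flipI i) :=
  cubic_of_invol (flipI_invol i) (by
    intro y hy j; rw [flipI_apply]; split_ifs
    · rw [abs_neg]; exact hy j
    · exact hy j)

lemma swapI_cubic (i j : Fin d) : CubicIsometry (swapI i j) :=
  cubic_of_invol (swapI_invol i j) (by intro y hy k; rw [swapI_apply]; exact hy _)

lemma int_invol {E : Set (Pt d)} (hE : CSym E) {U : Pt d ≃ₗᵢ[ℝ] Pt d}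
    (hU : ∀ y, U (U y) = y) (hc : CubicIsometry U) (g : Pt d → ℝ) :
    ∫ y in E, g (U y) = ∫ y in E, g y := by
  have hpre : U ⁻¹' E = E := by
    ext y
    constructor
    · intro hy; have := hE U hc _ hy; rwa [hU] at this
    · intro hy; exact hE U hc _ hy
  have := U.measurePreserving.setIntegral_preimage_emb
    U.toHomeomorph.measurableEmbedding g E
  rwa [hpre] at this

lemma int_coord {E : Set (Pt d)} (hE : CSym E) (i : Fin d) : ∫ y in E, y i = 0 := by
  have := int_invol hE (flipI_invol i) (flipI_cubic i) (fun y => y i)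
  simp only [flipI_apply, if_true, integral_neg] at this
  linarith

lemma int_coord2 {E : Set (Pt d)} (hE : CSym E) {i j : Fin d} (hij : i ≠ j) :
    ∫ y in E, y i * y j = 0 := by
  have := int_invol hE (flipI_invol i) (flipI_cubic i) (fun y => y i * y j)
  simp only [flipI_apply, if_true, if_neg hij.symm, neg_mul, integral_neg] at this
  linarith

lemma int_sq_eq {E : Set (Pt d)} (hE : CSym E) (i j : Fin d) :
    ∫ y in E, y i * y i = ∫ y in E, y j * y j := by
  have := int_invol hE (swapI_invol i j) (swapI_cubic i j) (fun y => y i * y i)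
  simp only [swapI_apply, Equiv.swap_apply_left] at this
  exact this.symm

lemma int_sq [NeZero d] {E : Set (Pt d)} (hE : CSym E) (hb : IsBounded E) (i : Fin d) :
    ∫ y in E, y i * y i = (∫ y in E, ‖y‖ ^ 2) / d := by
  have h1 : ∫ y in E, ‖y‖ ^ 2 = ∑ j, ∫ y in E, y j * y j := by
    rw [← integral_finset_sum _ (fun j _ => intOn (by fun_prop) hb)]
    congr 1; ext y
    rw [EuclideanSpace.norm_sq_eq]
    refine Finset.sum_congr rfl fun j _ => ?_
    rw [Real.norm_eq_abs, sq_abs, sq]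
  rw [h1, Finset.sum_congr rfl (fun j _ => int_sq_eq hE j i)]
  have : (d : ℝ) ≠ 0 := NeZero.ne _
  simp; field_simp

def tp (a : Fin d → ℝ) (b : Fin d → Fin d → ℝ) (y : Pt d) : ℝ :=
  ∑ i, a i * y i + ∑ i, ∑ j, b i j * (y i * y j)

lemma tp_cont (a : Fin d → ℝ) (b : Fin d → Fin d → ℝ) : Continuous (tp a b) := by
  unfold tp; fun_prop

lemma int_tp [NeZero d] {E : Set (Pt d)} (hE : CSym E) (hb : IsBounded E) (a : Fin d → ℝ)
    (b : Fin d → Fin d → ℝ) :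
    ∫ y in E, tp a b y = (∑ i, b i i) * (∫ y in E, ‖y‖ ^ 2) / d := by
  unfold tp
  rw [integral_add (intOn (by fun_prop) hb) (intOn (by fun_prop) hb),
    integral_finset_sum _ (fun j _ => intOn (by fun_prop) hb),
    integral_finset_sum _ (fun j _ => intOn (by fun_prop) hb)]
  simp only [integral_const_mul, int_coord hE, mul_zero, Finset.sum_const_zero, zero_add]
  rw [mul_div_assoc, Finset.sum_mul]
  refine Finset.sum_congr rfl fun i _ => ?_
  rw [integral_finset_sum _ (fun j _ => intOn (by fun_prop) hb)]
  simp only [integral_const_mul]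
  rw [Finset.sum_eq_single i, int_sq hE hb]
  · intro j _ hj; rw [int_coord2 hE hj.symm, mul_zero]
  · simp

noncomputable def ee (i : Fin d) : Pt d := EuclideanSpace.single i 1

lemma norm_ee (i : Fin d) (s : ℝ) : ‖s • ee i‖ = |s| := by
  simp [ee, norm_smul]

/-- coordinate average -/
noncomputable def kap (s : ℝ) (f : Pt d → ℝ) (x : Pt d) : ℝ :=
  (∑ i, (f (x + s • ee i) + f (x + (-s) • ee i))) / (2 * d)

lemma tp_ee (a : Fin d → ℝ) (b : Fin d → Fin d → ℝ) (i : Fin d) (s : ℝ) :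
    tp a b (s • ee i) = a i * s + b i i * s ^ 2 := by
  unfold tp ee
  simp only [PiLp.smul_apply, PiLp.single_apply, smul_eq_mul, mul_ite, mul_one, mul_zero,
    ite_mul, zero_mul]
  simp [sq]

lemma kap_tp [NeZero d] (a : Fin d → ℝ) (b : Fin d → Fin d → ℝ) (s : ℝ) :
    kap s (tp a b) 0 = (∑ i, b i i) * s ^ 2 / d := by
  have : (d : ℝ) ≠ 0 := NeZero.ne _
  unfold kap
  simp only [zero_add, tp_ee]
  have : ∀ i : Fin d, a i * s + b i i * s ^ 2 + (a i * -s + b i i * (-s) ^ 2) = 2 * s ^ 2 * b i i := by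
    intro i; ring
  simp only [this, ← Finset.mul_sum]
  field_simp

lemma kap_mono {f g : Pt d → ℝ} {s : ℝ} {x : Pt d}
    (h : ∀ i, f (x + s • ee i) ≤ g (x + s • ee i) ∧ f (x + (-s) • ee i) ≤ g (x + (-s) • ee i)) :
    kap s f x ≤ kap s g x := by
  unfold kap
  gcongr with i _
  · exact (h i).1
  · exact (h i).2

lemma kap_const [NeZero d] (c s : ℝ) (x : Pt d) : kap s (fun _ => c) x = c := by
  have : (d : ℝ) ≠ 0 := NeZero.ne _
  unfold kap; simp; field_simp; ring

lemma kap_add (f g : Pt d → ℝ) (s : ℝ) (x : Pt d) :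
    kap s (fun z => f z + g z) x = kap s f x + kap s g x := by
  unfold kap
  rw [← add_div, ← Finset.sum_add_distrib]
  congr 1
  exact Finset.sum_congr rfl fun i _ => by ring

lemma kap_mul (c : ℝ) (f : Pt d → ℝ) (s : ℝ) (x : Pt d) :
    kap s (fun z => c * f z) x = c * kap s f x := by
  unfold kap
  rw [mul_div_assoc', Finset.mul_sum]
  congr 1
  exact Finset.sum_congr rfl fun i _ => by ring

lemma kap_abs [NeZero d] {f : Pt d → ℝ} {s c : ℝ} {x : Pt d} (hs : 0 ≤ s)
    (h : ∀ y, ‖y‖ ≤ s → |f (x + y)| ≤ c) : |kap s f x| ≤ c := by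
  have n1 : ∀ i : Fin d, ‖s • ee i‖ ≤ s := fun i => by rw [norm_ee, abs_of_nonneg hs]
  have n2 : ∀ i : Fin d, ‖(-s) • ee i‖ ≤ s := fun i => by rw [norm_ee, abs_neg, abs_of_nonneg hs]
  rw [abs_le]
  constructor
  · rw [← kap_const (-c) s x]
    exact kap_mono fun i => ⟨(abs_le.1 (h _ (n1 i))).1, (abs_le.1 (h _ (n2 i))).1⟩
  · rw [← kap_const c s x]
    exact kap_mono fun i => ⟨(abs_le.1 (h _ (n1 i))).2, (abs_le.1 (h _ (n2 i))).2⟩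

def Expn (h : Pt d → ℝ) (x : Pt d) (ε ρ : ℝ) : Prop :=
  ∃ a b, ∀ y : Pt d, ‖y‖ ≤ ρ → |h (x + y) - h x - tp a b y| ≤ ε * ‖y‖ ^ 2

lemma QE [NeZero d] {h : Pt d → ℝ} (hc : Continuous h) {x : Pt d} {ε ρ s : ℝ} (hε : 0 ≤ ε)
    (hx : Expn h x ε ρ) (hs : 0 < s) (hsρ : s ≤ ρ) {E : Set (Pt d)} (mE : MeasurableSet E)
    (hE : CSym E) (hEρ : E ⊆ closedBall 0 ρ) :
    |(∫ y in E, h (x + y)) - volume.real E * h x - (∫ y in E, ‖y‖ ^ 2) * ((kap s h x - h x) / s ^ 2)|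
      ≤ 2 * ε * ∫ y in E, ‖y‖ ^ 2 := by
  obtain ⟨a, b, hab⟩ := hx
  have hb : IsBounded E := isBounded_closedBall.subset hEρ
  set m := ∫ y in E, ‖y‖ ^ 2 with hm
  have hm0 : 0 ≤ m := integral_nonneg fun y => by positivity
  set τ := (∑ i, b i i) / (d : ℝ) with hτ
  have i1 : IntegrableOn (fun y => h (x + y)) E := intOn (by fun_prop) hb
  have i2 : IntegrableOn (fun _ : Pt d => h x) E := intOn (by fun_prop) hb
  have i3 : IntegrableOn (tp a b) E := intOn (tp_cont _ _) hb
  have e1 : ∫ y in E, (h (x + y) - h x - tp a b y) =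
      (∫ y in E, h (x + y)) - volume.real E * h x - τ * m := by
    have i12 : IntegrableOn (fun y => h (x + y) - h x) E := i1.sub i2
    rw [integral_sub i12 i3, integral_sub i1 i2, setIntegral_const, smul_eq_mul,
      int_tp hE hb, hτ]
    ring
  have b1 : |(∫ y in E, h (x + y)) - volume.real E * h x - τ * m| ≤ ε * m := by
    rw [← e1, ← Real.norm_eq_abs, hm, ← integral_const_mul]
    refine (norm_integral_le_integral_norm _).trans ?_
    refine setIntegral_mono_on ((i1.sub i2).sub i3).norm (intOn (by fun_prop) hb) mE ?_
    intro y hy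
    exact hab y (by simpa using hEρ hy)
  have b2 : |kap s h x - h x - τ * s ^ 2| ≤ ε * s ^ 2 := by
    have h1 : kap s (fun z => h z + ((-h x) + (-1) * tp a b (z - x))) x
        = kap s h x - h x - τ * s ^ 2 := by
      rw [kap_add, kap_add, kap_const, kap_mul]
      have : kap s (fun z => tp a b (z - x)) x = kap s (tp a b) 0 := by
        unfold kap; simp
      rw [this, kap_tp, hτ]; ring
    rw [← h1]
    refine kap_abs hs.le fun y hy => ?_
    have := hab y (hy.trans hsρ)
    rw [show h (x + y) + (-h x + -1 * tp a b (x + y - x)) = h (x + y) - h x - tp a b y by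
      rw [add_sub_cancel_left]; ring]
    refine this.trans ?_
    gcongr
  have b3 : |(kap s h x - h x) / s ^ 2 - τ| ≤ ε := by
    have hs2 : 0 < s ^ 2 := by positivity
    have : (kap s h x - h x) / s ^ 2 - τ = (kap s h x - h x - τ * s ^ 2) / s ^ 2 := by
      field_simp
    rw [this, abs_div, abs_of_pos hs2, div_le_iff₀ hs2]; exact b2
  have b4 := mul_le_mul_of_nonneg_left b3 hm0
  rw [abs_le] at b1
  rw [← abs_of_nonneg hm0, ← abs_mul, abs_of_nonneg hm0, abs_le] at b4
  rw [abs_le]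
  constructor <;> nlinarith [b1.1, b1.2, b4.1, b4.2]

lemma sum_ee (y : Pt d) : y = ∑ i, y i • ee i := by
  have := (EuclideanSpace.basisFun (Fin d) ℝ).sum_repr y
  simpa [ee] using this.symm

lemma taylor_aux {G : Type*} [NormedAddCommGroup G] [NormedSpace ℝ G] {φ : G → ℝ}
    {f1 : G → G →L[ℝ] ℝ} {f2 : G → G →L[ℝ] G →L[ℝ] ℝ} (d1 : ∀ z, HasFDerivAt φ (f1 z) z)
    (d2 : ∀ z, HasFDerivAt f1 (f2 z) z) {w y : G} {ε ρ : ℝ} (hε : 0 ≤ ε)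
    (hρ' : ∀ u, dist u w ≤ ρ → ‖f2 u - f2 w‖ ≤ ε) (hy : ‖y‖ ≤ ρ) :
    |φ (w + y) - φ w - (f1 w y + 1 / 2 * f2 w y y)| ≤ ε * ‖y‖ ^ 2 := by
  have g1 : ∀ t : ℝ, HasDerivAt (fun t : ℝ => w + t • y) y t := fun t => by
    simpa using ((hasDerivAt_id t).smul_const y).const_add w
  have g2 : ∀ t : ℝ, HasDerivAt (fun t : ℝ => φ (w + t • y)) (f1 (w + t • y) y) t := fun t =>
    (d1 _).comp_hasDerivAt t (g1 t)
  have g3 : ∀ t : ℝ, HasDerivAt (fun t : ℝ => f1 (w + t • y) y) (f2 (w + t • y) y y) t := fun t => by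
    have := ((d2 _).comp_hasDerivAt t (g1 t)).clm_apply (hasDerivAt_const t y)
    simpa using this
  set p : ℝ → ℝ := fun t => f1 (w + t • y) y - t * f2 w y y with hp
  have p' : ∀ t, HasDerivAt p (f2 (w + t • y) y y - f2 w y y) t := fun t => by
    have := (g3 t).sub ((hasDerivAt_id t).mul_const (f2 w y y))
    rw [one_mul] at this
    exact this
  set q : ℝ → ℝ := fun t => φ (w + t • y) - (t * f1 w y + t ^ 2 * (1 / 2 * f2 w y y)) with hq
  have q' : ∀ t, HasDerivAt q (p t - p 0) t := fun t => by
    have := (g2 t).sub (((hasDerivAt_id t).mul_const (f1 w y)).add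
      (((hasDerivAt_id t).pow 2).mul_const (1 / 2 * f2 w y y)))
    have e : p t - p 0 = f1 (w + t • y) y -
        (1 * f1 w y + (((2 : ℕ) : ℝ) * (id t) ^ (2 - 1) * 1) * (1 / 2 * f2 w y y)) := by
      simp [hp]; ring
    rw [e]
    exact this
  have pb : ∀ t ∈ Set.Icc (0:ℝ) 1, ‖p t - p 0‖ ≤ ε * ‖y‖ ^ 2 := by
    intro t ht
    have := norm_image_sub_le_of_norm_deriv_le_segment' (f := p) (a := 0) (b := 1)
      (C := ε * ‖y‖ ^ 2) (fun x _ => (p' x).hasDerivWithinAt) (by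
        intro u hu
        have hdist : dist (w + u • y) w ≤ ρ := by
          rw [dist_eq_norm, add_sub_cancel_left, norm_smul, Real.norm_eq_abs, abs_of_nonneg hu.1]
          nlinarith [norm_nonneg y, hu.2]
        have h1 := hρ' _ hdist
        have h2 := (f2 (w + u • y) - f2 w).le_opNorm y
        have h3 := ((f2 (w + u • y) - f2 w) y).le_opNorm y
        have h4 : (f2 (w + u • y) - f2 w) y y = f2 (w + u • y) y y - f2 w y y := rfl
        rw [h4] at h3
        refine h3.trans ?_
        have h5 := h2.trans (mul_le_mul_of_nonneg_right h1 (norm_nonneg y))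
        have := mul_le_mul_of_nonneg_right h5 (norm_nonneg y)
        rw [sq]; linarith) t ht
    refine this.trans ?_
    have : 0 ≤ ε * ‖y‖ ^ 2 := by positivity
    nlinarith [ht.2]
  have := norm_image_sub_le_of_norm_deriv_le_segment_01' (f := q) (C := ε * ‖y‖ ^ 2)
    (fun x _ => (q' x).hasDerivWithinAt) (fun x hx => pb x ⟨hx.1, hx.2.le⟩)
  rw [Real.norm_eq_abs] at this
  convert this using 2
  simp [hq]; ring

lemma tp_clm (L1 : Pt d →L[ℝ] ℝ) (L2 : Pt d →L[ℝ] Pt d →L[ℝ] ℝ) (y : Pt d) :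
    tp (fun i => L1 (ee i)) (fun i j => 1 / 2 * L2 (ee i) (ee j)) y = L1 y + 1 / 2 * L2 y y := by
  unfold tp
  have h1 : L1 y = ∑ i, L1 (ee i) * y i := by
    conv_lhs => rw [sum_ee y]
    rw [map_sum]
    exact Finset.sum_congr rfl fun i _ => by rw [map_smul, smul_eq_mul, mul_comm]
  have h2 : ∀ z, L2 z y = ∑ j, L2 z (ee j) * y j := by
    intro z
    conv_lhs => rw [sum_ee y]
    rw [map_sum]
    exact Finset.sum_congr rfl fun i _ => by rw [map_smul, smul_eq_mul, mul_comm]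
  have h3 : ∀ z, L2 y z = ∑ i, y i * L2 (ee i) z := by
    intro z
    have : ∀ u, L2 u z = (L2.flip z) u := fun u => rfl
    rw [this]
    conv_lhs => rw [sum_ee y]
    rw [map_sum]
    exact Finset.sum_congr rfl fun i _ => by rw [map_smul, smul_eq_mul, this]
  rw [h1, h3, Finset.mul_sum]
  congr 1
  refine Finset.sum_congr rfl fun i _ => ?_
  rw [h2, Finset.mul_sum, Finset.mul_sum]
  refine Finset.sum_congr rfl fun j _ => ?_
  ring

lemma c1_bounds {G V : Type*} [NormedAddCommGroup G] [NormedSpace ℝ G]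
    [NormedAddCommGroup V] [NormedSpace ℝ V] {ψ : G → V} (hψ : ContDiff ℝ 1 ψ)
    (hs : HasCompactSupport ψ) :
    (∃ M : ℝ, ∀ w, ‖fderiv ℝ ψ w‖ ≤ M) ∧ (∀ ε > 0, ∃ ρ > 0, ∀ u w, dist u w < ρ →
      ‖fderiv ℝ ψ u - fderiv ℝ ψ w‖ < ε) ∧ (∃ M : ℝ, ∀ w, ‖ψ w‖ ≤ M) := by
  have c2 : Continuous (fderiv ℝ ψ) := hψ.continuous_fderiv (by norm_num)
  have s2 : HasCompactSupport (fderiv ℝ ψ) := hs.fderiv ℝ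
  refine ⟨c2.bounded_above_of_compact_support s2, fun ε hε => ?_,
    hψ.continuous.bounded_above_of_compact_support hs⟩
  have uc := s2.uniformContinuous_of_continuous c2
  obtain ⟨ρ, hρ, hρ'⟩ := Metric.uniformContinuous_iff.1 uc ε hε
  refine ⟨ρ, hρ, fun u w h => ?_⟩
  have := hρ' h
  rwa [dist_eq_norm] at this

lemma taylor_sub {G : Type*} [NormedAddCommGroup G] [NormedSpace ℝ G] {φ : G → ℝ} (hφ : ContDiff ℝ 2 φ) (hs : HasCompactSupport φ) :
    ∃ (f1 : G → G →L[ℝ] ℝ) (f2 : G → G →L[ℝ] G →L[ℝ] ℝ) (M : ℝ),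
      Continuous f1 ∧ Continuous f2 ∧ (∀ w, ‖f1 w‖ ≤ M) ∧ (∀ w, ‖f2 w‖ ≤ M) ∧
      ∀ ε > 0, ∃ ρ > 0, ∀ w y : G, ‖y‖ ≤ ρ →
        |φ (w + y) - φ w - (f1 w y + 1 / 2 * f2 w y y)| ≤ ε * ‖y‖ ^ 2 := by
  have c1 : ContDiff ℝ 1 (fderiv ℝ φ) := hφ.fderiv_right (by norm_num)
  have c2 : Continuous (fderiv ℝ (fderiv ℝ φ)) :=
    c1.continuous_fderiv (by norm_num)
  have s1 : HasCompactSupport (fderiv ℝ φ) := hs.fderiv ℝ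
  obtain ⟨⟨M2, hM2⟩, hu, ⟨M1, hM1⟩⟩ := c1_bounds c1 s1
  refine ⟨fderiv ℝ φ, fderiv ℝ (fderiv ℝ φ), max M1 M2, c1.continuous, c2,
    fun w => (hM1 w).trans (le_max_left _ _), fun w => (hM2 w).trans (le_max_right _ _), ?_⟩
  intro ε hε
  obtain ⟨ρ, hρ, hρ'⟩ := hu ε hε
  refine ⟨ρ / 2, by positivity, fun w y hy => ?_⟩
  refine taylor_aux (ρ := ρ / 2) (fun z => (hφ.differentiable (by norm_num) z).hasFDerivAt)
    (fun z => (c1.differentiable (by norm_num) z).hasFDerivAt) hε.le (fun u hu => ?_) hy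
  exact (hρ' u w (by linarith)).le

lemma taylor {φ : Pt d → ℝ} (hφ : ContDiff ℝ 2 φ) (hs : HasCompactSupport φ) :
    ∃ (a : Fin d → Pt d → ℝ) (b : Fin d → Fin d → Pt d → ℝ) (M : ℝ),
      (∀ i, Continuous (a i)) ∧ (∀ i j, Continuous (b i j)) ∧ (∀ i w, |a i w| ≤ M) ∧
      (∀ i j w, |b i j w| ≤ M) ∧ ∀ ε > 0, ∃ ρ > 0, ∀ w y : Pt d, ‖y‖ ≤ ρ →
        |φ (w + y) - φ w - tp (fun i => a i w) (fun i j => b i j w) y| ≤ ε * ‖y‖ ^ 2 := by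
  obtain ⟨f1, f2, M, c1, c2, hM1, hM2, hT⟩ := taylor_sub hφ hs
  have nee : ∀ i : Fin d, ‖ee i‖ = 1 := fun i => by simp [ee]
  refine ⟨fun i w => f1 w (ee i), fun i j w => 1 / 2 * f2 w (ee i) (ee j), M, ?_, ?_, ?_, ?_, ?_⟩
  · intro i; exact c1.clm_apply continuous_const
  · intro i j; exact continuous_const.mul ((c2.clm_apply continuous_const).clm_apply continuous_const)
  · intro i w
    have := (f1 w).le_opNorm (ee i)
    rw [nee, mul_one] at this
    exact this.trans (hM1 w)
  · intro i j w
    have h1 := (f2 w (ee i)).le_opNorm (ee j)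
    have h2 := (f2 w).le_opNorm (ee i)
    rw [nee, mul_one] at h1 h2
    have h3 := h1.trans (h2.trans (hM2 w))
    rw [Real.norm_eq_abs] at h3
    rw [abs_mul]
    have : |(1/2:ℝ)| = 1/2 := by norm_num
    rw [this]
    have := abs_nonneg (f2 w (ee i) (ee j))
    linarith
  · intro ε hε
    obtain ⟨ρ, hρ, hρ'⟩ := hT ε hε
    refine ⟨ρ, hρ, fun w y hy => ?_⟩
    rw [tp_clm (f1 w) (f2 w) y]
    exact hρ' w y hy

lemma exists_k_aux {G : Type*} [NormedAddCommGroup G] [NormedSpace ℝ G] [FiniteDimensional ℝ G]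
    [HasContDiffBump G] (R : ℝ) : ∃ χ : G → ℝ, Continuous χ ∧ HasCompactSupport χ ∧
    ∀ x, ‖x‖ ≤ R → χ x = 1 := by
  let χ : ContDiffBump (0 : G) := ⟨|R| + 1, |R| + 2, by positivity, by linarith⟩
  refine ⟨χ, χ.continuous, χ.hasCompactSupport, ?_⟩
  intro x hx
  refine χ.one_of_mem_closedBall ?_
  simp only [mem_closedBall, dist_zero_right]
  have := le_abs_self R
  show ‖x‖ ≤ |R| + 1
  linarith

lemma exists_k (R : ℝ) : ∃ k : Pt d → ℝ, Continuous k ∧ HasCompactSupport k ∧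
    ∀ x, ‖x‖ ≤ R → k x = ‖x‖ ^ 2 := by
  obtain ⟨χ, h1, h2, h3⟩ := exists_k_aux (G := Pt d) R
  have h4 : Continuous (fun x : Pt d => χ x * ‖x‖ ^ 2) := by fun_prop
  have h5 : HasCompactSupport (fun x : Pt d => χ x * ‖x‖ ^ 2) := h2.mul_right
  refine ⟨_, h4, h5, ?_⟩
  intro x hx
  show χ x * ‖x‖ ^ 2 = ‖x‖ ^ 2
  rw [h3 x hx, one_mul]

lemma tp_k (x y : Pt d) : ‖x + y‖ ^ 2 - ‖x‖ ^ 2 = tp (fun i => 2 * x i)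
    (fun i j => if i = j then 1 else 0) y := by
  rw [EuclideanSpace.norm_sq_eq, EuclideanSpace.norm_sq_eq, ← Finset.sum_sub_distrib]
  unfold tp
  rw [← Finset.sum_add_distrib]
  refine Finset.sum_congr rfl fun i _ => ?_
  simp
  ring

lemma k_int [NeZero d] {k : Pt d → ℝ} {R : ℝ} (hk : ∀ x, ‖x‖ ≤ R → k x = ‖x‖ ^ 2)
    {x : Pt d} (hx : ‖x‖ + 1 ≤ R) {E : Set (Pt d)} (mE : MeasurableSet E) (hE : CSym E)
    (hE1 : E ⊆ closedBall 0 1) :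
    ∫ y in E, k (x + y) = volume.real E * k x + ∫ y in E, ‖y‖ ^ 2 := by
  have hb : IsBounded E := isBounded_closedBall.subset hE1
  have hd : (d : ℝ) ≠ 0 := NeZero.ne _
  have e : ∫ y in E, k (x + y) = ∫ y in E, (k x + tp (fun i => 2 * x i)
    (fun i j => if i = j then 1 else 0) y) := by
    refine setIntegral_congr_fun mE fun y hy => ?_
    have hy1 : ‖y‖ ≤ 1 := by simpa using hE1 hy
    have := norm_add_le x y
    show k (x + y) = k x + _
    rw [hk _ (by linarith), hk x (by linarith), ← tp_k]; ring
  rw [e, integral_add (intOn (by fun_prop) hb) (intOn (tp_cont _ _) hb), setIntegral_const,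
    smul_eq_mul, int_tp hE hb]
  simp
  field_simp

lemma k_kap [NeZero d] {k : Pt d → ℝ} {R : ℝ} (hk : ∀ x, ‖x‖ ≤ R → k x = ‖x‖ ^ 2)
    {x : Pt d} (hx : ‖x‖ + 1 ≤ R) {s : ℝ} (hs : 0 ≤ s) (hs1 : s ≤ 1) : kap s k x = k x + s ^ 2 := by
  have hd : (d : ℝ) ≠ 0 := NeZero.ne _
  have key : ∀ y, ‖y‖ ≤ 1 → k (x + y) = k x + tp (fun i => 2 * x i)
    (fun i j => if i = j then 1 else 0) y := by
    intro y hy1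
    have := norm_add_le x y
    rw [hk _ (by linarith), hk x (by linarith), ← tp_k]; ring
  have : kap s k x = kap s (fun z => k x + tp (fun i => 2 * x i)
    (fun i j => if i = j then 1 else 0) (z - x)) x := by
    unfold kap
    congr 1
    refine Finset.sum_congr rfl fun i _ => ?_
    rw [key _ (by rw [norm_ee, abs_of_nonneg hs]; exact hs1),
      key _ (by rw [norm_ee, abs_neg, abs_of_nonneg hs]; exact hs1)]
    simp
  rw [this, kap_add, kap_const]
  have : ∀ a b, kap s (fun z => tp a b (z - x)) x = kap s (tp a b) 0 := by
    intro a b; unfold kap; simp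
  rw [this, kap_tp]
  simp
  field_simp

end symm

end

section

section iter
variable {d : ℕ}

open Classical in
noncomputable def itr (s : ℝ) (D : Set (Pt d)) (h : Pt d → ℝ) : ℕ → Pt d → ℝ
  | 0 => h
  | n + 1 => fun x => if x ∈ D then kap s (itr s D h n) x else itr s D h n x

lemma kap_meas {s : ℝ} {f : Pt d → ℝ} (hf : Measurable f) : Measurable (kap s f) := by
  unfold kap
  refine Measurable.div_const (Finset.measurable_sum _ fun i _ => ?_) _
  exact (hf.comp (measurable_id.add_const _)).add (hf.comp (measurable_id.add_const _))

lemma iter_exists [NeZero d] {s K : ℝ} (hs : 0 ≤ s) {D W : Set (Pt d)} (hD : MeasurableSet D)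
    (hDW : D ⊆ W) {h : Pt d → ℝ} (hm : Measurable h) (hK : ∀ x, |h x| ≤ K)
    (hW : ∀ x ∈ W, kap s h x ≤ h x) :
    ∃ f : Pt d → ℝ, Measurable f ∧ (∀ x, |f x| ≤ K) ∧ (∀ x, f x ≤ h x) ∧ (∀ x ∉ D, f x = h x) ∧
      (∀ x ∈ D, kap s f x = f x) ∧ (∀ x ∈ W, kap s f x ≤ f x) := by
  classical
  set F := itr s D h with hF
  have F0 : F 0 = h := rfl
  have FD : ∀ n, ∀ x ∈ D, F (n + 1) x = kap s (F n) x := fun n x hx => by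
    simp [hF, itr, hx]
  have FnD : ∀ n, ∀ x ∉ D, F (n + 1) x = F n x := fun n x hx => by
    simp [hF, itr, hx]
  have FnD' : ∀ n, ∀ x ∉ D, F n x = h x := by
    intro n x hx
    induction n with
    | zero => rfl
    | succ n ih => rw [FnD n x hx, ih]
  have Fm : ∀ n, Measurable (F n) := by
    intro n
    induction n with
    | zero => exact hm
    | succ n ih => exact Measurable.ite hD (kap_meas ih) ih
  have FK : ∀ n x, |F n x| ≤ K := by
    intro n
    induction n with
    | zero => exact hK
    | succ n ih =>
      intro x
      by_cases hx : x ∈ D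
      · rw [FD n x hx]; exact kap_abs hs fun y _ => ih _
      · rw [FnD n x hx]; exact ih x
  have Fdec : ∀ n x, F (n + 1) x ≤ F n x := by
    intro n
    induction n with
    | zero =>
      intro x
      by_cases hx : x ∈ D
      · rw [FD 0 x hx]; exact hW x (hDW hx)
      · rw [FnD 0 x hx]
    | succ n ih =>
      intro x
      by_cases hx : x ∈ D
      · rw [FD (n + 1) x hx, FD n x hx]; exact kap_mono fun i => ⟨ih _, ih _⟩
      · rw [FnD (n + 1) x hx]
  have Fanti : ∀ x, Antitone fun n => F n x := fun x => antitone_nat_of_succ_le fun n => Fdec n x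
  have Fbdd : ∀ x, BddBelow (Set.range fun n => F n x) := fun x =>
    ⟨-K, by rintro _ ⟨n, rfl⟩; exact (abs_le.1 (FK n x)).1⟩
  set f : Pt d → ℝ := fun x => ⨅ n, F n x with hf
  have ft : ∀ x, Filter.Tendsto (fun n => F n x) Filter.atTop (nhds (f x)) := fun x =>
    tendsto_atTop_ciInf (Fanti x) (Fbdd x)
  have kt : ∀ x, Filter.Tendsto (fun n => kap s (F n) x) Filter.atTop (nhds (kap s f x)) := by
    intro x
    unfold kap
    exact (tendsto_finset_sum _ fun i _ => (ft _).add (ft _)).div_const _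
  have fh : ∀ x, f x ≤ h x := fun x => ciInf_le (Fbdd x) 0
  have fnD : ∀ x ∉ D, f x = h x := by
    intro x hx
    refine tendsto_nhds_unique (ft x) ?_
    simp only [FnD' _ x hx]; exact tendsto_const_nhds
  have fD : ∀ x ∈ D, kap s f x = f x := by
    intro x hx
    refine tendsto_nhds_unique (kt x) ?_
    have := (ft x).comp (Filter.tendsto_add_atTop_nat 1)
    refine this.congr fun n => FD n x hx
  refine ⟨f, ?_, ?_, fh, fnD, fD, ?_⟩
  · exact measurable_of_tendsto_metrizable Fm (tendsto_pi_nhds.2 ft)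
  · intro x
    exact le_of_tendsto (ft x).abs (Filter.Eventually.of_forall fun n => FK n x)
  · intro x hx
    by_cases hxD : x ∈ D
    · exact (fD x hxD).le
    · rw [fnD x hxD]
      exact (kap_mono fun i => ⟨fh _, fh _⟩).trans (hW x hx)

end iter

section conv
variable {d : ℕ}

structure Moll (φ : Pt d → ℝ) (τ : ℝ) : Prop where
  cd : ContDiff ℝ 2 φ
  cs : HasCompactSupport φ
  nn : ∀ y, 0 ≤ φ y
  one : ∫ y, φ y = 1
  supp : ∀ y, φ y ≠ 0 → ‖y‖ < τ

lemma exists_moll {τ : ℝ} (hτ : 0 < τ) : ∃ φ : Pt d → ℝ, Moll φ τ := by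
  let χ : ContDiffBump (0 : Pt d) := ⟨τ / 2, τ, by positivity, by linarith⟩
  refine ⟨χ.normed volume, ?_, χ.hasCompactSupport_normed, χ.nonneg_normed, χ.integral_normed, ?_⟩
  · exact χ.contDiff_normed
  · intro y hy
    have : y ∈ Function.support (χ.normed volume) := hy
    rw [χ.support_normed_eq] at this
    simpa using this

noncomputable def cv (φ f : Pt d → ℝ) (x : Pt d) : ℝ := ∫ z, φ (x - z) * f z

lemma cv_eq (φ f : Pt d → ℝ) (x : Pt d) : cv φ f x = ∫ y, φ y * f (x - y) := by
  unfold cv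
  rw [← integral_sub_left_eq_self (fun z => φ (x - z) * f z) volume x]
  simp

variable {φ : Pt d → ℝ} {τ : ℝ}

lemma Moll.int (hφ : Moll φ τ) : Integrable φ :=
  hφ.cd.continuous.integrable_of_hasCompactSupport hφ.cs

lemma Moll.intu (hφ : Moll φ τ) {u : Pt d → ℝ} (hu : Measurable u) {K : ℝ} (hK : ∀ y, |u y| ≤ K) :
    Integrable (fun y => φ y * u y) := by
  refine Integrable.mono' (hφ.int.mul_const K)
    (hφ.cd.continuous.measurable.mul hu).aestronglyMeasurable (Filter.Eventually.of_forall fun y => ?_)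
  rw [Real.norm_eq_abs, abs_mul, abs_of_nonneg (hφ.nn y)]
  exact mul_le_mul_of_nonneg_left (hK y) (hφ.nn y)

lemma Moll.mono (hφ : Moll φ τ) {u v : Pt d → ℝ} (hu : Measurable u) {K : ℝ} (hK : ∀ y, |u y| ≤ K)
    (hv : Measurable v) (hK' : ∀ y, |v y| ≤ K) (huv : ∀ y, ‖y‖ < τ → u y ≤ v y) :
    ∫ y, φ y * u y ≤ ∫ y, φ y * v y := by
  refine integral_mono (hφ.intu hu hK) (hφ.intu hv hK') fun y => ?_
  by_cases h0 : φ y = 0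
  · simp [h0]
  · exact mul_le_mul_of_nonneg_left (huv y (hφ.supp y h0)) (hφ.nn y)

lemma Moll.const (hφ : Moll φ τ) (c : ℝ) : ∫ y, φ y * c = c := by
  rw [integral_mul_const, hφ.one, one_mul]

lemma Moll.le (hφ : Moll φ τ) {u : Pt d → ℝ} (hu : Measurable u) {K : ℝ} (hK : ∀ y, |u y| ≤ K)
    {c : ℝ} (huv : ∀ y, ‖y‖ < τ → u y ≤ c) : ∫ y, φ y * u y ≤ c := by
  rw [← hφ.const c]
  exact hφ.mono (K := max K |c|) hu (fun y => (hK y).trans (le_max_left _ _)) measurable_const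
    (fun _ => le_max_right _ _) huv

lemma Moll.ge (hφ : Moll φ τ) {u : Pt d → ℝ} (hu : Measurable u) {K : ℝ} (hK : ∀ y, |u y| ≤ K)
    {c : ℝ} (huv : ∀ y, ‖y‖ < τ → c ≤ u y) : c ≤ ∫ y, φ y * u y := by
  rw [← hφ.const c]
  exact hφ.mono (K := max K |c|) measurable_const
    (fun _ => le_max_right _ _) hu (fun y => (hK y).trans (le_max_left _ _)) huv

lemma meas_sub {f : Pt d → ℝ} (hf : Measurable f) (x : Pt d) : Measurable fun y => f (x - y) :=
  hf.comp (measurable_const.sub measurable_id)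

lemma Moll.bound (hφ : Moll φ τ) {f : Pt d → ℝ} (hf : Measurable f) {K : ℝ} (hK : ∀ y, |f y| ≤ K)
    (x : Pt d) : |cv φ f x| ≤ K := by
  rw [cv_eq, abs_le]
  exact ⟨hφ.ge (meas_sub hf x) (fun y => hK _) fun y _ => (abs_le.1 (hK _)).1,
    hφ.le (meas_sub hf x) (fun y => hK _) fun y _ => (abs_le.1 (hK _)).2⟩

lemma Moll.kap (hφ : Moll φ τ) {f : Pt d → ℝ} (hf : Measurable f) {K : ℝ} (hK : ∀ y, |f y| ≤ K)
    (s : ℝ) (x : Pt d) : kap s (cv φ f) x = ∫ y, φ y * kap s f (x - y) := by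
  have I : ∀ z, Integrable fun y => φ y * f (z - y) := fun z => hφ.intu (meas_sub hf z) fun y => hK _
  have e : ∀ y, φ y * _root_.kap s f (x - y) =
      (∑ i, (φ y * f (x + s • ee i - y) + φ y * f (x + (-s) • ee i - y))) / (2 * d) := by
    intro y
    unfold _root_.kap
    rw [mul_div_assoc', Finset.mul_sum]
    congr 1
    refine Finset.sum_congr rfl fun i _ => ?_
    rw [mul_add, sub_add_eq_add_sub, sub_add_eq_add_sub]
  have I2 : ∀ i : Fin d, Integrable (fun y => φ y * f (x + s • ee i - y) +
      φ y * f (x + (-s) • ee i - y)) := fun i => (I _).add (I _)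
  simp only [e]
  rw [integral_div, integral_finset_sum _ fun i _ => I2 i]
  unfold _root_.kap
  congr 1
  refine Finset.sum_congr rfl fun i _ => ?_
  rw [integral_add (I _) (I _), cv_eq, cv_eq]

lemma Moll.uc (hφ : Moll φ τ) {f : Pt d → ℝ} (hf : Integrable f) : UniformContinuous (cv φ f) := by
  have uc := hφ.cs.uniformContinuous_of_continuous hφ.cd.continuous
  obtain ⟨M, hM⟩ := hφ.cd.continuous.bounded_above_of_compact_support hφ.cs
  have I : ∀ x, Integrable fun z => φ (x - z) * f z := fun x => by
    refine hf.bdd_mul (c := M) ?_ (Filter.Eventually.of_forall fun z => hM _)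
    have hcc := hφ.cd.continuous
    exact Continuous.aestronglyMeasurable (by fun_prop)
  rw [Metric.uniformContinuous_iff] at uc ⊢
  intro ε hε
  set J := ∫ z, |f z| with hJ
  have hJ0 : 0 ≤ J := integral_nonneg fun z => abs_nonneg _
  obtain ⟨δ, hδ, hδ'⟩ := uc (ε / (J + 1)) (by positivity)
  refine ⟨δ, hδ, fun {x x'} hxx => ?_⟩
  rw [Real.dist_eq]
  unfold cv
  rw [← integral_sub (I x) (I x')]
  have h1 : |∫ z, (φ (x - z) * f z - φ (x' - z) * f z)| ≤ ∫ z, ε / (J + 1) * |f z| := by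
    rw [← Real.norm_eq_abs]
    refine (norm_integral_le_integral_norm _).trans (integral_mono ((I x).sub (I x')).norm
      (hf.abs.const_mul _) fun z => ?_)
    show ‖φ (x - z) * f z - φ (x' - z) * f z‖ ≤ _
    rw [← sub_mul, Real.norm_eq_abs, abs_mul]
    refine mul_le_mul_of_nonneg_right ?_ (abs_nonneg _)
    have := hδ' (a := x - z) (b := x' - z) (by simpa using hxx)
    rw [Real.dist_eq] at this; exact this.le
  rw [integral_const_mul] at h1
  refine h1.trans_lt ?_
  rw [div_mul_eq_mul_div, div_lt_iff₀ (by positivity)]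
  nlinarith

lemma Moll.exp (hφ : Moll φ τ) {ε : ℝ} (hε : 0 < ε) : ∃ ρ > 0, ∀ f : Pt d → ℝ, Integrable f →
    ∀ x, Expn (cv φ f) x (ε * ∫ z, |f z|) ρ := by
  obtain ⟨a, b, M, ac, bc, aM, bM, H⟩ := taylor hφ.cd hφ.cs
  obtain ⟨ρ, hρ, Hρ⟩ := H ε hε
  obtain ⟨M', hM'⟩ := hφ.cd.continuous.bounded_above_of_compact_support hφ.cs
  refine ⟨ρ, hρ, fun f hf x => ?_⟩
  have I : ∀ (g : Pt d → ℝ) (C : ℝ), Continuous g → (∀ z, |g z| ≤ C) → ∀ x,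
      Integrable fun z => g (x - z) * f z := fun g C hg hC x => by
    refine hf.bdd_mul (c := C) ?_ (Filter.Eventually.of_forall fun z => hC _)
    exact Continuous.aestronglyMeasurable (by fun_prop)
  refine ⟨fun i => ∫ z, a i (x - z) * f z, fun i j => ∫ z, b i j (x - z) * f z, fun y hy => ?_⟩
  have Iφ := I φ M' hφ.cd.continuous hM'
  have Ia := fun i => I (a i) M (ac i) (aM i) x
  have Ib := fun i j => I (b i j) M (bc i j) (bM i j) x
  have It : Integrable fun z => tp (fun i => a i (x - z)) (fun i j => b i j (x - z)) y * f z := by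
    unfold tp
    have e : (fun z => (∑ i, a i (x - z) * y i + ∑ i, ∑ j, b i j (x - z) * (y i * y j)) * f z) =
        fun z => (∑ i, (a i (x - z) * f z) * y i + ∑ i, ∑ j, (b i j (x - z) * f z) * (y i * y j)) := by
      ext z
      rw [add_mul, Finset.sum_mul, Finset.sum_mul]
      congr 1
      · exact Finset.sum_congr rfl fun i _ => by ring
      · refine Finset.sum_congr rfl fun i _ => ?_
        rw [Finset.sum_mul]
        exact Finset.sum_congr rfl fun j _ => by ring
    rw [e]
    exact (integrable_finset_sum _ fun i _ => (Ia i).mul_const _).add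
      (integrable_finset_sum _ fun i _ => integrable_finset_sum _ fun j _ => (Ib i j).mul_const _)
  have et : tp (fun i => ∫ z, a i (x - z) * f z) (fun i j => ∫ z, b i j (x - z) * f z) y =
      ∫ z, tp (fun i => a i (x - z)) (fun i j => b i j (x - z)) y * f z := by
    unfold tp
    have e : (fun z => (∑ i, a i (x - z) * y i + ∑ i, ∑ j, b i j (x - z) * (y i * y j)) * f z) =
        fun z => (∑ i, (a i (x - z) * f z) * y i + ∑ i, ∑ j, (b i j (x - z) * f z) * (y i * y j)) := by
      ext z
      rw [add_mul, Finset.sum_mul, Finset.sum_mul]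
      congr 1
      · exact Finset.sum_congr rfl fun i _ => by ring
      · refine Finset.sum_congr rfl fun i _ => ?_
        rw [Finset.sum_mul]
        exact Finset.sum_congr rfl fun j _ => by ring
    rw [e, integral_add (integrable_finset_sum _ fun i _ => (Ia i).mul_const _)
      (integrable_finset_sum _ fun i _ => integrable_finset_sum _ fun j _ => (Ib i j).mul_const _),
      integral_finset_sum _ fun i _ => (Ia i).mul_const _,
      integral_finset_sum _ fun i _ => integrable_finset_sum _ fun j _ => (Ib i j).mul_const _]
    simp only [integral_mul_const]
    congr 1
    refine Finset.sum_congr rfl fun i _ => ?_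
    rw [integral_finset_sum _ fun j _ => (Ib i j).mul_const _]
    simp only [integral_mul_const]
  rw [et]
  unfold cv
  have Id : Integrable fun z => φ (x + y - z) * f z - φ (x - z) * f z := (Iφ (x + y)).sub (Iφ x)
  rw [← integral_sub (Iφ (x + y)) (Iφ x), ← integral_sub Id It, ← Real.norm_eq_abs]
  refine (norm_integral_le_integral_norm _).trans ?_
  have : ε * (∫ z, |f z|) * ‖y‖ ^ 2 = ∫ z, (ε * ‖y‖ ^ 2) * |f z| := by
    rw [integral_const_mul]; ring
  rw [this]
  refine integral_mono (Id.sub It).norm (hf.abs.const_mul _) fun z => ?_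
  have h1 := Hρ (x - z) y hy
  rw [sub_add_eq_add_sub] at h1
  show ‖φ (x + y - z) * f z - φ (x - z) * f z - _ * f z‖ ≤ _
  rw [← sub_mul, ← sub_mul, Real.norm_eq_abs, abs_mul]
  exact mul_le_mul_of_nonneg_right h1 (abs_nonneg _)

end conv

lemma shrink {d : ℕ} {A : Set (Pt d)} (hA : GoodSet A) {η : ℝ} (hη : 0 < η) :
    ∃ r₀ > 0, ∀ r, 0 < r → r ≤ r₀ → ∃ A', GoodSet A' ∧ A' ⊆ A ∧
      (∀ v : Pt d, ‖v‖ ≤ r → (· + v) '' A' ⊆ A) ∧ volume.real A ≤ volume.real A' + η := by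
  obtain ⟨C, hCA, hC, hv⟩ := hA.1.measurableSet.exists_isCompact_lt_add hA.lt_top
    (ε := ENNReal.ofReal η) (by simpa using hη)
  obtain ⟨δ, hδ, hδ'⟩ := hC.exists_thickening_subset_open hA.1 hCA
  refine ⟨δ / 2, by positivity, fun r hr hr' => ?_⟩
  have hsub : ∀ v : Pt d, ‖v‖ ≤ r → (· + v) '' thickening r C ⊆ A := by
    rintro v hv _ ⟨z, hz, rfl⟩
    apply hδ'
    rw [mem_thickening_iff] at hz ⊢
    obtain ⟨c, hc, hzc⟩ := hz
    refine ⟨c, hc, ?_⟩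
    have h1 : dist (z + v) z ≤ r := by simpa [dist_eq_norm] using hv
    have := dist_triangle (z + v) z c
    show dist (z + v) c < δ
    linarith
  have hsub0 : thickening r C ⊆ A := by
    have := hsub 0 (by simpa using hr.le)
    simpa using this
  have g : GoodSet (thickening r C) := ⟨isOpen_thickening, hA.2.subset hsub0⟩
  refine ⟨thickening r C, g, hsub0, hsub, ?_⟩
  have h1 : volume A ≤ volume (thickening r C) + ENNReal.ofReal η :=
    hv.le.trans (add_le_add_left (measure_mono (self_subset_thickening hr C)) _)
  have h2 := ENNReal.toReal_mono (by simpa using g.lt_top) h1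
  rw [ENNReal.toReal_add g.lt_top (by simp), ENNReal.toReal_ofReal hη.le] at h2
  exact h2

end

section

lemma Expn.neg {d : ℕ} {h : Pt d → ℝ} {x : Pt d} {ε ρ : ℝ} (H : Expn h x ε ρ) :
    Expn (fun z => -h z) x ε ρ := by
  obtain ⟨a, b, H⟩ := H
  refine ⟨fun i => -a i, fun i j => -b i j, fun y hy => ?_⟩
  have e : tp (fun i => -a i) (fun i j => -b i j) y = - tp a b y := by
    unfold tp
    simp only [neg_mul, Finset.sum_neg_distrib, neg_add]
  rw [e, ← abs_neg]
  convert H y hy using 2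
  ring

lemma Expn.weak {d : ℕ} {h : Pt d → ℝ} {x : Pt d} {ε ρ ε' ρ' : ℝ} (H : Expn h x ε ρ)
    (h1 : ε ≤ ε') (h2 : ρ' ≤ ρ) : Expn h x ε' ρ' := by
  obtain ⟨a, b, H⟩ := H
  refine ⟨a, b, fun y hy => (H y (hy.trans h2)).trans ?_⟩
  gcongr

lemma key_app {d : ℕ} [NeZero d] {Φ : Set (Pt d) → Set (Pt d) → Set (Pt d)} (S : Sys d Φ)
    {A B : Set (Pt d)} (hA : GoodSet A) (hB : GoodSet B) {R : ℝ}
    (hR : Φ A B ⊆ ball 0 R) {g : Pt d → ℝ} (uc : UniformContinuous g) {K : ℝ}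
    (hK : ∀ x, |g x| ≤ K) {η ρ s : ℝ} (hη : 0 < η) (hρ1 : ρ ≤ 1) (hs : 0 < s) (hsρ : s ≤ ρ)
    (H : ∀ x ∈ Φ A B, Expn g x η ρ ∧ kap s g x ≤ g x) :
    ∫ x in Φ A B, g x ≤ (∫ x in A, g x) + (∫ x in B, g x) +
      3 * η * (volume.real (ball (0 : Pt d) R) * R ^ 2) := by
  obtain ⟨k, kc, ks, hk⟩ := exists_k (d := d) (R + 3)
  obtain ⟨M, hM⟩ := kc.bounded_above_of_compact_support ks
  have kuc := ks.uniformContinuous_of_continuous kc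
  have gS := S.good hA hB
  have nx : ∀ x ∈ Φ A B, ‖x‖ < R := fun x hx => by simpa using hR hx
  have c2 : Continuous fun x => 3 * η * k x := by fun_prop
  have uc2 : UniformContinuous fun x => 3 * η * k x := by
    exact (ks.mul_left (f := fun _ => 3 * η)).uniformContinuous_of_continuous c2
  have main := S.key (h := fun x => g x - 3 * η * k x) (uc.sub uc2)
    (K := K + 3 * η * M) (fun x => by
      refine (abs_sub _ _).trans (add_le_add (hK x) ?_)
      rw [abs_mul, abs_of_pos (by positivity : 0 < 3 * η)]
      have := hM x
      rw [Real.norm_eq_abs] at this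
      gcongr) hA hB hη (hs.trans_le hsρ) ?_
  · have sp : ∀ E : Set (Pt d), IsBounded E → ∫ x in E, (g x - 3 * η * k x) =
        (∫ x in E, g x) - 3 * η * ∫ x in E, k x := fun E hE => by
      rw [integral_sub (intOn uc.continuous hE) (intOn c2 hE), integral_const_mul]
    rw [sp _ gS.2, sp _ hA.2, sp _ hB.2] at main
    have p : ∀ E : Set (Pt d), GoodSet E → E ⊆ Φ A B → 0 ≤ ∫ x in E, k x := fun E hE hs =>
      setIntegral_nonneg hE.1.measurableSet fun x hx => by
        rw [hk x (by linarith [nx x (hs hx)])]; positivity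
    have pA := p A hA (S.sub_l hA hB)
    have pB := p B hB (S.sub_r hA hB)
    have q : ∫ x in Φ A B, k x ≤ volume.real (ball (0 : Pt d) R) * R ^ 2 := by
      refine (int_le kc gS.1.measurableSet gS.2 (c := R ^ 2) fun x hx => ?_).trans ?_
      · rw [hk x (by linarith [nx x hx])]
        have := nx x hx
        gcongr
      · gcongr
        exact (good_ball 0 R).lt_top
    have q' := mul_le_mul_of_nonneg_left q (by positivity : 0 ≤ 3 * η)
    have pA' := mul_nonneg (by positivity : 0 ≤ 3 * η) pA
    have pB' := mul_nonneg (by positivity : 0 ≤ 3 * η) pB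
    linarith
  · intro x hx E mE hE hEρ
    have hb : IsBounded E := isBounded_closedBall.subset hEρ
    have xc : Continuous fun y : Pt d => x + y := by fun_prop
    have q1 := QE uc.continuous hη.le (H x hx).1 hs hsρ mE hE hEρ
    have q2 := k_int hk (x := x) (by linarith [nx x hx]) mE hE
      (hEρ.trans (closedBall_subset_closedBall hρ1))
    have e : ∫ y in E, (g (x + y) - 3 * η * k (x + y)) =
        (∫ y in E, g (x + y)) - 3 * η * ∫ y in E, k (x + y) := by
      have i1 : IntegrableOn (fun y => g (x + y)) E := intOn (uc.continuous.comp xc) hb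
      have i2 : IntegrableOn (fun y => 3 * η * k (x + y)) E := intOn (c2.comp xc) hb
      rw [integral_sub i1 i2,
        integral_const_mul]
    show ∫ y in E, (g (x + y) - 3 * η * k (x + y)) ≤ _
    rw [e, q2]
    have m0 : 0 ≤ ∫ y in E, ‖y‖ ^ 2 := integral_nonneg fun y => by positivity
    have n0 : (kap s g x - g x) / s ^ 2 ≤ 0 :=
      div_nonpos_of_nonpos_of_nonneg (by linarith [(H x hx).2]) (by positivity)
    have := mul_nonpos_of_nonneg_of_nonpos m0 n0
    have := (abs_le.1 q1).2
    nlinarith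

end

section

lemma exists_hat {d : ℕ} [NeZero d] {Ω Ωr : Set (Pt d)} {R r : ℝ} (hR : Ω ⊆ ball 0 R)
    (hr : 0 < r) (hr1 : r ≤ 1) (hΩ : ∀ v : Pt d, ‖v‖ ≤ r → ∀ x ∈ Ωr, x + v ∈ Ω)
    {h : Pt d → ℝ} (hc : Continuous h) (hcs : HasCompactSupport h) {K : ℝ} (hK : ∀ x, |h x| ≤ K)
    {s₀ : ℝ} (hs₀ : 0 < s₀)
    (hk : ∀ s, 0 < s → s ≤ s₀ → ∀ x : Pt d, ‖x‖ ≤ R + 2 → kap s h x ≤ h x)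
    {η : ℝ} (hη : 0 < η) :
    ∃ (g : Pt d → ℝ) (ρ s : ℝ), UniformContinuous g ∧ (∀ x, |g x| ≤ K) ∧ 0 < s ∧ s ≤ ρ ∧ ρ ≤ 1 ∧
      (∀ x, Expn g x η ρ) ∧ (∀ x, g x ≤ h x + η) ∧ (∀ x ∉ Ω, h x - η ≤ g x) ∧
      (∀ x, ‖x‖ ≤ R + 1 → kap s g x ≤ g x) ∧ (∀ x ∈ Ωr, kap s g x = g x) := by
  have hK0 : 0 ≤ K := (abs_nonneg _).trans (hK 0)
  have huc := hcs.uniformContinuous_of_continuous hc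
  obtain ⟨ρ₁, hρ₁, H1⟩ := Metric.uniformContinuous_iff.1 huc η hη
  have H1' : ∀ x y : Pt d, ‖y‖ < ρ₁ → |h (x - y) - h x| < η := fun x y hy => by
    have := @H1 (x - y) x (by rw [dist_eq_norm]; simpa using hy)
    rwa [Real.dist_eq] at this
  set D := thickening (r / 2) Ωr with hD
  have Dmem : ∀ x z : Pt d, z ∈ Ωr → ‖x - z‖ < r / 2 → x ∈ D := fun x z hz hx => by
    rw [hD, mem_thickening_iff]
    exact ⟨z, hz, by rwa [dist_eq_norm]⟩
  have DΩ : ∀ x y : Pt d, x - y ∈ D → ‖y‖ < r / 2 → x ∈ Ω := fun x y hx hy => by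
    rw [hD, mem_thickening_iff] at hx
    obtain ⟨z, hz, hxz⟩ := hx
    rw [dist_eq_norm] at hxz
    have := hΩ (x - z) (by
      have e : x - z = (x - y - z) + y := by abel
      rw [e]
      exact (norm_add_le _ _).trans (by linarith)) z hz
    simpa using this
  have DR : D ⊆ ball 0 R := fun x hx => hR (DΩ x 0 (by simpa using hx) (by simpa using hr))
  set τ := min ρ₁ (r / 2) with hτ
  have τ0 : 0 < τ := lt_min hρ₁ (by positivity)
  have τ1 : τ ≤ ρ₁ := min_le_left _ _
  have τ2 : τ ≤ r / 2 := min_le_right _ _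
  obtain ⟨φ, hφ⟩ := exists_moll (d := d) τ0
  have hint : Integrable h := hc.integrable_of_hasCompactSupport hcs
  set V := volume.real (ball (0 : Pt d) R)
  set K₁ := K * V + ∫ z, |h z| with hK₁
  have K₁0 : 0 ≤ K₁ := add_nonneg (mul_nonneg hK0 measureReal_nonneg)
    (integral_nonneg fun z => abs_nonneg _)
  obtain ⟨ρ₂, hρ₂, H2⟩ := hφ.exp (ε := η / (K₁ + 1)) (by positivity)
  set ρ := min ρ₂ 1
  have ρ0 : 0 < ρ := lt_min hρ₂ one_pos
  set s := min s₀ ρ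
  have s0 : 0 < s := lt_min hs₀ ρ0
  obtain ⟨f, fm, fK, fh, fD, fk, fW⟩ := iter_exists (W := {x : Pt d | ‖x‖ ≤ R + 2}) s0.le
    (isOpen_thickening.measurableSet : MeasurableSet D) (fun x hx => by
      have := DR hx
      rw [mem_ball_zero_iff] at this
      show ‖x‖ ≤ R + 2
      linarith) hc.measurable hK (fun x hx => hk s s0 (min_le_left _ _) x hx)
  have indI : Integrable ((ball (0 : Pt d) R).indicator fun _ => K) :=
    (integrable_indicator_iff measurableSet_ball).2
      (integrableOn_const (good_ball (0 : Pt d) R).lt_top)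
  have fb : ∀ x, |f x| ≤ (ball (0 : Pt d) R).indicator (fun _ => K) x + |h x| := fun x => by
    by_cases hx : x ∈ ball (0 : Pt d) R
    · rw [Set.indicator_of_mem hx]
      have := fK x
      have := abs_nonneg (h x)
      linarith
    · rw [fD x fun h => hx (DR h), Set.indicator_of_notMem hx, zero_add]
  have fI : Integrable f := (indI.add hint.abs).mono' fm.aestronglyMeasurable
    (Filter.Eventually.of_forall fun x => fb x)
  have fI1 : ∫ z, |f z| ≤ K₁ := by
    refine (integral_mono fI.abs (indI.add hint.abs) fb).trans (le_of_eq ?_)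
    have e : ∫ a, ((ball (0 : Pt d) R).indicator (fun _ => K) + fun x => |h x|) a =
      (∫ a, (ball (0 : Pt d) R).indicator (fun _ => K) a) + ∫ x, |h x| := integral_add indI hint.abs
    rw [e, integral_indicator measurableSet_ball, setIntegral_const, smul_eq_mul, mul_comm]
  refine ⟨cv φ f, ρ, s, hφ.uc fI, hφ.bound fm fK, s0, min_le_right _ _, min_le_right _ _, ?_, ?_, ?_,
    ?_, ?_⟩
  · intro x
    refine (H2 f fI x).weak ?_ (min_le_left _ _)
    rw [div_mul_eq_mul_div, div_le_iff₀ (by positivity)]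
    gcongr
    linarith
  · intro x
    rw [cv_eq]
    refine hφ.le (meas_sub fm x) (fun y => fK _) fun y hy => ?_
    have := fh (x - y)
    have := (abs_lt.1 (H1' x y (by linarith))).2
    linarith
  · intro x hx
    rw [cv_eq]
    refine hφ.ge (meas_sub fm x) (fun y => fK _) fun y hy => ?_
    rw [fD _ fun h => hx (DΩ x y h (by linarith))]
    have := (abs_lt.1 (H1' x y (by linarith))).1
    linarith
  · intro x hx
    rw [hφ.kap fm fK, cv_eq]
    refine hφ.mono (K := K) (meas_sub (kap_meas fm) x) (fun y => kap_abs s0.le fun y _ => fK _)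
      (meas_sub fm x) (fun y => fK _) fun y hy => ?_
    apply fW
    show ‖x - y‖ ≤ R + 2
    have := norm_sub_le x y
    linarith
  · intro x hx
    rw [hφ.kap fm fK, cv_eq]
    have hD' : ∀ y : Pt d, ‖y‖ < τ → x - y ∈ D := fun y hy =>
      Dmem _ x hx (by simpa using hy.trans_le τ2)
    refine le_antisymm ?_ ?_
    · exact hφ.mono (K := K) (meas_sub (kap_meas fm) x) (fun y => kap_abs s0.le fun y _ => fK _)
        (meas_sub fm x) (fun y => fK _) fun y hy => (fk _ (hD' y hy)).le
    · exact hφ.mono (K := K) (meas_sub fm x) (fun y => fK _)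
        (meas_sub (kap_meas fm) x) (fun y => kap_abs s0.le fun y _ => fK _)
        fun y hy => (fk _ (hD' y hy)).ge

end


lemma diff_int {d : ℕ} {g : Pt d → ℝ} (gc : Continuous g) {K : ℝ} (gK : ∀ x, |g x| ≤ K)
    {E U : Set (Pt d)} (hE : GoodSet E) (hU : GoodSet U) (hUE : U ⊆ E) {η : ℝ}
    (hv : volume.real E ≤ volume.real U + η) :
    |(∫ x in E, g x) - ∫ x in U, g x| ≤ K * η := by
  have hK0 : 0 ≤ K := (abs_nonneg _).trans (gK 0)
  have mU := hU.1.measurableSet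
  have b : IsBounded (E \ U) := hE.2.subset Set.sdiff_subset
  have m : MeasurableSet (E \ U) := hE.1.measurableSet.diff mU
  have e1 := int_split gc hE.2 mU
  have e2 := vol_split hE.2 mU
  rw [Set.inter_eq_self_of_subset_right hUE] at e1 e2
  have u := int_le gc m b (c := K) fun y _ => (abs_le.1 (gK y)).2
  have l := le_int gc m b (c := -K) fun y _ => (abs_le.1 (gK y)).1
  have w : volume.real (E \ U) * K ≤ K * η := by
    rw [mul_comm]; gcongr; linarith
  rw [abs_le]
  constructor <;> linarith

lemma main_eta {d : ℕ} [NeZero d] {Φ Φ' : Set (Pt d) → Set (Pt d) → Set (Pt d)} (S : Sys d Φ)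
    (S' : Sys d Φ') {A B : Set (Pt d)} (hA : GoodSet A) (hB : GoodSet B) {R : ℝ}
    (hR : Φ A B ⊆ ball 0 R) (hR' : Φ' A B ⊆ ball 0 R)
    {h : Pt d → ℝ} (hc : Continuous h) (hcs : HasCompactSupport h) {K : ℝ} (hK : ∀ x, |h x| ≤ K)
    {s₀ : ℝ} (hs₀ : 0 < s₀)
    (hk : ∀ s, 0 < s → s ≤ s₀ → ∀ x : Pt d, ‖x‖ ≤ R + 2 → kap s h x ≤ h x)
    {η : ℝ} (hη : 0 < η) :
    ∫ x in Φ' A B, h x ≤ (∫ x in Φ A B, h x) + (6 * (volume.real (ball (0 : Pt d) R) * R ^ 2) +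
      4 * K + 2 * volume.real (ball (0 : Pt d) R)) * η := by
  obtain ⟨r₁, hr₁, H₁⟩ := shrink hA hη
  obtain ⟨r₂, hr₂, H₂⟩ := shrink hB hη
  set r := min (min r₁ r₂) 1 with hr
  have r0 : 0 < r := lt_min (lt_min hr₁ hr₂) one_pos
  obtain ⟨A', gA', sA, tA, vA⟩ := H₁ r r0 ((min_le_left _ _).trans (min_le_left _ _))
  obtain ⟨B', gB', sB, tB, vB⟩ := H₂ r r0 ((min_le_left _ _).trans (min_le_right _ _))
  have gS := S.good hA hB
  have gS' := S'.good hA hB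
  have gSr := S.good gA' gB'
  have hsub : Φ A' B' ⊆ Φ A B := S.mono2 gA' gB' hA hB sA sB
  obtain ⟨g, ρ, s, uc, gK, s0, sρ, ρ1, ex, gu, gl, gk, gk'⟩ := exists_hat (Ωr := Φ A' B') hR r0
    (min_le_right _ _) (fun v hv x hx => by
      have := S.mono2 (gA'.trans v) (gB'.trans v) hA hB (tA v hv) (tB v hv)
      rw [S.ax.translate _ _ _ gA' gB'] at this
      exact this ⟨x, hx, rfl⟩) hc hcs hK hs₀ hk hη
  have gc := uc.continuous
  have k1 := key_app S' hA hB hR' uc gK hη ρ1 s0 sρ fun x hx => ⟨ex x, gk x (by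
    have := hR' hx
    rw [mem_ball_zero_iff] at this
    linarith)⟩
  have k2 := key_app S gA' gB' (hsub.trans hR) (g := fun z => -g z) uc.neg (K := K)
    (fun x => by rw [abs_neg]; exact gK x) hη ρ1 s0 sρ fun x hx => ⟨(ex x).neg, by
      have : kap s (fun z => -g z) x = -kap s g x := by simpa using kap_mul (-1) g s x
      rw [this, gk' x hx]⟩
  simp only [integral_neg] at k2
  have dA := (abs_le.1 (diff_int gc gK hA gA' sA vA)).2
  have dB := (abs_le.1 (diff_int gc gK hB gB' sB vB)).2
  have dS := (abs_le.1 (diff_int gc gK gS gSr hsub (η := 2 * η) (by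
    rw [S.cons hA hB, S.cons gA' gB']; linarith))).1
  have cu : Continuous fun x => h x - g x := hc.sub gc
  have mS := gS.1.measurableSet
  have mS' := gS'.1.measurableSet
  have e1 := int_split cu gS'.2 mS
  have e2 := int_split cu gS.2 mS'
  rw [Set.inter_comm] at e2
  have u := int_le cu (mS'.diff mS) (gS'.2.subset Set.sdiff_subset) (c := η) fun y hy => by
    linarith [gl y hy.2]
  have l := le_int cu (mS.diff mS') (gS.2.subset Set.sdiff_subset) (c := -η) fun y hy => by
    linarith [gu y]
  have v1 : volume.real (Φ' A B \ Φ A B) * η ≤ volume.real (ball (0 : Pt d) R) * η := by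
    gcongr
    · exact (good_ball 0 R).lt_top
    · exact Set.sdiff_subset.trans hR'
  have v2 : volume.real (Φ A B \ Φ' A B) * η ≤ volume.real (ball (0 : Pt d) R) * η := by
    gcongr
    · exact (good_ball 0 R).lt_top
    · exact Set.sdiff_subset.trans hR
  rw [integral_sub (intOn hc gS'.2) (intOn gc gS'.2)] at e1
  rw [integral_sub (intOn hc gS.2) (intOn gc gS.2)] at e2
  linarith

lemma main_ineq {d : ℕ} [NeZero d] {Φ Φ' : Set (Pt d) → Set (Pt d) → Set (Pt d)} (S : Sys d Φ)
    (S' : Sys d Φ') {A B : Set (Pt d)} (hA : GoodSet A) (hB : GoodSet B) {R : ℝ}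
    (hR : Φ A B ⊆ ball 0 R) (hR' : Φ' A B ⊆ ball 0 R)
    {h : Pt d → ℝ} (hc : Continuous h) (hcs : HasCompactSupport h)
    {s₀ : ℝ} (hs₀ : 0 < s₀)
    (hk : ∀ s, 0 < s → s ≤ s₀ → ∀ x : Pt d, ‖x‖ ≤ R + 2 → kap s h x ≤ h x) :
    ∫ x in Φ' A B, h x ≤ ∫ x in Φ A B, h x := by
  obtain ⟨K, hK⟩ := hc.bounded_above_of_compact_support hcs
  have hK0 : 0 ≤ K := (norm_nonneg _).trans (hK 0)
  set V := volume.real (ball (0 : Pt d) R) with hV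
  have V0 : 0 ≤ V := measureReal_nonneg
  refine le_of_forall_pos_le_add fun ε hε => ?_
  set C := 6 * (V * R ^ 2) + 4 * K + 2 * V with hC
  have C0 : 0 ≤ C := by positivity
  refine (main_eta S S' hA hB hR hR' hc hcs hK hs₀ hk (η := ε / (C + 1)) (by positivity)).trans ?_
  have : C * (ε / (C + 1)) ≤ ε := by
    rw [mul_div_assoc', div_le_iff₀ (by positivity)]
    nlinarith
  exact add_le_add le_rfl this

lemma test_le {d : ℕ} [NeZero d] {Φ Φ' : Set (Pt d) → Set (Pt d) → Set (Pt d)} (S : Sys d Φ)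
    (S' : Sys d Φ') {A B : Set (Pt d)} (hA : GoodSet A) (hB : GoodSet B)
    {ψ : Pt d → ℝ} (hψ : ContDiff ℝ 2 ψ) (hs : HasCompactSupport ψ) :
    ∫ x in Φ' A B, ψ x ≤ ∫ x in Φ A B, ψ x := by
  have gS := S.good hA hB
  have gS' := S'.good hA hB
  obtain ⟨R, hR⟩ := (gS.2.union gS'.2).subset_ball 0
  have h1 := Set.subset_union_left.trans hR
  have h2 := Set.subset_union_right.trans hR
  obtain ⟨k, kc, ks, hk⟩ := exists_k (d := d) (R + 4)
  obtain ⟨a, b, M, -, -, -, bM, H⟩ := taylor hψ hs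
  obtain ⟨ρ, hρ, Hρ⟩ := H 1 one_pos
  have hd : (0 : ℝ) < d := by exact_mod_cast Nat.pos_of_ne_zero (NeZero.ne d)
  have hM0 : 0 ≤ M := (abs_nonneg _).trans (bM 0 0 0)
  have kψ : ∀ s, 0 < s → s ≤ ρ → ∀ x, kap s ψ x ≤ ψ x + (M + 1) * s ^ 2 := by
    intro s s0 sρ x
    set t := tp (fun i => a i x) (fun i j => b i j x)
    have e1 : kap s ψ x ≤ ψ x + kap s t 0 + s ^ 2 := by
      have e : ψ x + kap s t 0 + s ^ 2 = kap s (fun y => (ψ x + s ^ 2) + t y) 0 := by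
        rw [kap_add, kap_const]; ring
      rw [e]
      have e' : kap s ψ x = kap s (fun y => ψ (x + y)) 0 := by
        unfold kap; simp only [zero_add]
      rw [e']
      have q : ∀ y : Pt d, ‖y‖ = s → ψ (x + y) ≤ ψ x + s ^ 2 + t y := fun y hy => by
        have := (abs_le.1 (Hρ x y (by linarith))).2
        rw [hy] at this
        linarith
      refine kap_mono fun i => ⟨?_, ?_⟩
      · rw [zero_add]
        exact q _ (by rw [norm_ee, abs_of_pos s0])
      · rw [zero_add]
        exact q _ (by rw [norm_ee, abs_neg, abs_of_pos s0])
    rw [kap_tp] at e1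
    have e2 : (∑ i, b i i x) ≤ d * M := by
      have : (∑ i, b i i x) ≤ ∑ _i : Fin d, M := Finset.sum_le_sum fun i _ => (abs_le.1 (bM i i x)).2
      simpa using this
    have e3 : (∑ i, b i i x) * s ^ 2 / d ≤ M * s ^ 2 := by
      rw [div_le_iff₀ hd]
      have := mul_le_mul_of_nonneg_right e2 (by positivity : 0 ≤ s ^ 2)
      linarith
    linarith
  have ks' : HasCompactSupport fun x => -(M + 1) * k x := ks.mul_left
  have kc' : Continuous fun x => -(M + 1) * k x := by fun_prop
  have ψc := hψ.continuous
  have kk : ∀ s, 0 < s → s ≤ min ρ 1 → ∀ x : Pt d, ‖x‖ ≤ R + 2 →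
      kap s (fun x => -(M + 1) * k x) x = -(M + 1) * k x - (M + 1) * s ^ 2 := by
    intro s s0 s1 x hx
    rw [kap_mul, k_kap hk (by linarith) s0.le (s1.trans (min_le_right _ _))]
    ring
  have m1 := main_ineq S S' hA hB h1 h2 (h := fun x => ψ x + -(M + 1) * k x) (ψc.add kc')
    (hs.add ks') (s₀ := min ρ 1) (lt_min hρ one_pos) fun s s0 s1 x hx => by
      rw [kap_add, kk s s0 s1 x hx]
      linarith [kψ s s0 (s1.trans (min_le_left _ _)) x]
  have m2 := main_ineq S' S hA hB h2 h1 (h := fun x => -(M + 1) * k x) kc'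
    ks' (s₀ := min ρ 1) (lt_min hρ one_pos) fun s s0 s1 x hx => by
      rw [kk s s0 s1 x hx]
      have : 0 ≤ (M + 1) * s ^ 2 := by positivity
      linarith
  rw [integral_add (intOn ψc gS.2) (intOn kc' gS.2), integral_add (intOn ψc gS'.2) (intOn kc' gS'.2)]
    at m1
  linarith

lemma final {d : ℕ} [NeZero d] {Φ Φ' : Set (Pt d) → Set (Pt d) → Set (Pt d)} (S : Sys d Φ)
    (S' : Sys d Φ') {A B : Set (Pt d)} (hA : GoodSet A) (hB : GoodSet B) : Φ A B = Φ' A B := by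
  have gS := S.good hA hB
  have gS' := S'.good hA hB
  have i : ∀ E : Set (Pt d), GoodSet E → LocallyIntegrable (E.indicator fun _ => (1 : ℝ)) := fun E hE =>
    ((integrable_indicator_iff hE.1.measurableSet).2 (integrableOn_const hE.lt_top)).locallyIntegrable
  have ae := ae_eq_of_integral_contDiff_smul_eq (i _ gS) (i _ gS') (fun g hg hgs => by
    have e : ∀ E : Set (Pt d), GoodSet E → ∫ x, g x • E.indicator (fun _ => (1 : ℝ)) x =
        ∫ x in E, g x := fun E hE => by
      rw [← integral_indicator hE.1.measurableSet]
      congr 1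
      ext x
      by_cases hx : x ∈ E <;> simp [hx]
    rw [e _ gS, e _ gS']
    have hg2 : ContDiff ℝ 2 g := by exact_mod_cast contDiff_infty.1 hg 2
    exact le_antisymm (test_le S' S hA hB hg2 hgs) (test_le S S' hA hB hg2 hgs))
  have z : ∀ x, (Φ A B).indicator (fun _ => (1 : ℝ)) x = (Φ' A B).indicator (fun _ => (1 : ℝ)) x →
      (x ∈ Φ A B ↔ x ∈ Φ' A B) := fun x hx => by
    by_cases h1 : x ∈ Φ A B <;> by_cases h2 : x ∈ Φ' A B <;> simp_all
  refine subset_antisymm ?_ ?_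
  · refine (S'.bulky A B hA hB).sub gS.1 ?_
    refine measure_mono_null (fun x hx => ?_) (ae_iff.1 ae)
    exact fun h => hx.2 ((z x h).1 hx.1)
  · refine (S.bulky A B hA hB).sub gS'.1 ?_
    refine measure_mono_null (fun x hx => ?_) (ae_iff.1 ae)
    exact fun h => hx.2 ((z x h).2 hx.1)

/-- Let ⊕ and ⊕' be two sums of open sets in ℝ^d, each satisfying the six
requirements exactly and each producing bulky outputs. Then ⊕ and ⊕' coincide on bounded
open sets. -/
theorem sum_unique (d : ℕ)
    (Φ Φ' : Set (Pt d) → Set (Pt d) → Set (Pt d))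
    (hax : SumAxioms d Φ) (hax' : SumAxioms d Φ')
    (hbulky : ∀ A B, GoodSet A → GoodSet B → Bulky (Φ A B))
    (hbulky' : ∀ A B, GoodSet A → GoodSet B → Bulky (Φ' A B))
    (A B : Set (Pt d)) (hA : GoodSet A) (hB : GoodSet B) :
    Φ A B = Φ' A B := by
  rcases Nat.eq_zero_or_pos d with rfl | hd
  · exfalso
    have gU : GoodSet (ball (0 : Pt 0) 1) := good_ball 0 1
    have e : ball (0 : Pt 0) 1 = Set.univ := by
      ext x; simp [Subsingleton.elim x 0]
    have c := hax.conserve _ _ gU gU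
    have le : volume (Φ (ball (0 : Pt 0) 1) (ball 0 1)) ≤ volume (ball (0 : Pt 0) 1) :=
      measure_mono (by rw [e]; exact Set.subset_univ _)
    rw [c] at le
    have p : volume (ball (0 : Pt 0) 1) ≠ 0 := (measure_ball_pos volume _ one_pos).ne'
    have := ENNReal.lt_add_right gU.lt_top p
    exact absurd le (not_le.2 this)
  · haveI : NeZero d := ⟨hd.ne'⟩
    exact final ⟨hax, hbulky⟩ ⟨hax', hbulky'⟩ hA hB
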